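/- Let C be a finitely generated, recursively presented group: C = PresentedGroup R for some k ∈ ℕ and some subset R of the free group on k generators that is recursively enumerable (e.g., R is the range of a function f : ℕ → FreeGroup(Fin k) such that n ↦ (f n).toWord is computable). Then there exist a finitely presented group H and an injective group homomorphism ι : C → H such that for every m ∈ ℕ: (1) tor_m(H) equals the normal closure in H of ι(tor_m(C)); and (2) the preimage under ι of tor_m(H) equals tor_m(C). -/

import Mathlib

/-- The ascending chain of normal subgroups `tor₀(G) = 1`,
`tor_{n+1}(G) = ⟪elements of finite order mod tor_n(G)⟫`. -/
def tor (G : Type*) [Group G] : ℕ → Subgroup G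
  | 0 => ⊥
  | n + 1 => Subgroup.normalClosure {g : G | ∃ k : ℕ, 0 < k ∧ g ^ k ∈ tor G n}

namespace HNNExtension

variable {K Z : Type*} [Group K] [Group Z]

/-- The HNN extension of `K` whose stable letter conjugates `j₁ z` to `j₂ z`. -/
abbrev OfHoms (j₁ j₂ : Z →* K) (h₁ : Function.Injective j₁) (h₂ : Function.Injective j₂) :=
  HNNExtension K j₁.range j₂.range
    ((MonoidHom.ofInjective h₁).symm.trans (MonoidHom.ofInjective h₂))

namespace OfHoms

variable {j₁ j₂ : Z →* K} {h₁ : Function.Injective j₁} {h₂ : Function.Injective j₂}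

theorem t_mul_of_left (z : Z) :
    (t * of (j₁ z) : OfHoms j₁ j₂ h₁ h₂) = of (j₂ z) * t := by
  have := t_mul_of (φ := (MonoidHom.ofInjective h₁).symm.trans (MonoidHom.ofInjective h₂))
    (MonoidHom.ofInjective h₁ z)
  rwa [MulEquiv.trans_apply, MulEquiv.symm_apply_apply] at this

variable (h₁ h₂) in
/-- The universal property of `HNNExtension.OfHoms`. -/
noncomputable def desc {H : Type*} [Group H] (f : K →* H) (x : H)
    (hx : ∀ z, x * f (j₁ z) = f (j₂ z) * x) : OfHoms j₁ j₂ h₁ h₂ →* H :=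
  lift f x (by
    rintro ⟨_, z, rfl⟩
    have : (MonoidHom.ofInjective h₁).symm ⟨j₁ z, ⟨z, rfl⟩⟩ = z :=
      (MonoidHom.ofInjective h₁).symm_apply_eq.2 rfl
    rw [MulEquiv.trans_apply, this]
    exact hx z)

@[simp]
theorem desc_of {H : Type*} [Group H] (f : K →* H) (x : H)
    (hx : ∀ z, x * f (j₁ z) = f (j₂ z) * x) (k : K) : desc h₁ h₂ f x hx (of k) = f k := by
  simp [desc]

@[simp]
theorem desc_t {H : Type*} [Group H] (f : K →* H) (x : H)
    (hx : ∀ z, x * f (j₁ z) = f (j₂ z) * x) : desc h₁ h₂ f x hx t = x := by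
  simp [desc]

variable (j₁ j₂) in
/-- The source homomorphism of conjugation by `t ^ u`. -/
def side (u : ℤˣ) : Z →* K := if u = 1 then j₁ else j₂

theorem range_side (u : ℤˣ) : (side j₁ j₂ u).range = toSubgroup j₁.range j₂.range u := by
  rcases Int.units_eq_one_or u with rfl | rfl
  · rfl
  · rfl

theorem t_zpow_mul_of_side (u : ℤˣ) (z : Z) :
    (t ^ (u : ℤ) * of (side j₁ j₂ u z) : OfHoms j₁ j₂ h₁ h₂) =
      of (side j₁ j₂ (-u) z) * t ^ (u : ℤ) := by
  rcases Int.units_eq_one_or u with rfl | rfl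
  · simpa [side] using t_mul_of_left z
  · have := t_mul_of_left (h₁ := h₁) (h₂ := h₂) z
    have h : (t⁻¹ * of (j₂ z) : OfHoms j₁ j₂ h₁ h₂) = of (j₁ z) * t⁻¹ := by
      rw [inv_mul_eq_iff_eq_mul, ← mul_assoc, this, mul_assoc, mul_inv_cancel, mul_one]
    simpa [side] using h

variable (h₁ h₂) in
/-- The value of a word in the stable letter and the base group. -/
noncomputable def wordProd (l : List (ℤˣ × K)) : OfHoms j₁ j₂ h₁ h₂ :=
  (l.map fun x => t ^ (x.1 : ℤ) * of x.2).prod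

variable (j₁ j₂) in
/-- No subword `t ^ u * g * t ^ (-u)` of the word lies in the base group. -/
def Reduced (l : List (ℤˣ × K)) : Prop :=
  l.IsChain fun a b => a.2 ∈ (side j₁ j₂ a.1).range → a.1 = b.1

@[simp] theorem wordProd_nil : wordProd h₁ h₂ [] = 1 := rfl

@[simp] theorem wordProd_cons (a : ℤˣ × K) (l : List (ℤˣ × K)) :
    wordProd h₁ h₂ (a :: l) = t ^ (a.1 : ℤ) * of a.2 * wordProd h₁ h₂ l := rfl

@[simp] theorem wordProd_append (l l' : List (ℤˣ × K)) :
    wordProd h₁ h₂ (l ++ l') = wordProd h₁ h₂ l * wordProd h₁ h₂ l' := by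
  simp [wordProd]

theorem eq_nil_of_of_mul_wordProd_mem_range {g : K} {l : List (ℤˣ × K)}
    (hl : Reduced j₁ j₂ l)
    (h : of g * wordProd h₁ h₂ l ∈ (of : K →* OfHoms j₁ j₂ h₁ h₂).range) : l = [] := by
  let w : NormalWord.ReducedWord K j₁.range j₂.range :=
    ⟨g, l, by
      refine List.IsChain.imp ?_ hl
      intro a b hab
      rw [range_side] at hab
      exact hab⟩
  exact ReducedWord.toList_eq_nil_of_mem_of_range (φ := _) w h

section Paths

variable {V : Type*} (M : V → Subgroup K) (E : V → V → Prop) (v₀ : V)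

/-- The edges traversed by `t ^ u`. -/
def Edge (u : ℤˣ) (v v' : V) : Prop := if u = 1 then E v v' else E v' v

theorem edge_neg (u : ℤˣ) (v v' : V) : Edge E (-u) v v' ↔ Edge E u v' v := by
  rcases Int.units_eq_one_or u with rfl | rfl <;> simp [Edge]

/-- The word follows a path of edges that ends at `v₀`, with base letters in the subgroups at the
visited vertices. -/
def Admissible : V → List (ℤˣ × K) → Prop
  | v, [] => v = v₀
  | v, a :: l => ∃ v', Edge E a.1 v' v ∧ a.2 ∈ M v' ∧ Admissible v' l

variable (h₁ h₂) in
/-- The elements represented by reduced admissible words starting at `v`. -/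
def reach (v : V) : Set (OfHoms j₁ j₂ h₁ h₂) :=
  {x | ∃ g ∈ M v, ∃ l, Reduced j₁ j₂ l ∧ Admissible M E v₀ v l ∧ x = of g * wordProd h₁ h₂ l}

variable {M E v₀}

theorem of_mul_mem_reach {v : V} {x : OfHoms j₁ j₂ h₁ h₂} (hx : x ∈ reach h₁ h₂ M E v₀ v) {g : K}
    (hg : g ∈ M v) : of g * x ∈ reach h₁ h₂ M E v₀ v := by
  obtain ⟨k, hk, l, hl, ha, rfl⟩ := hx
  exact ⟨g * k, mul_mem hg hk, l, hl, ha, by rw [map_mul, mul_assoc]⟩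

theorem t_zpow_mul_mem_reach
    (hE : ∀ v v', E v v' → ∀ z, j₁ z ∈ M v ↔ j₂ z ∈ M v')
    (hf : ∀ v v' v'', E v v' → E v v'' → v' = v'')
    (hi : ∀ v v' v'', E v v'' → E v' v'' → v = v')
    {u : ℤˣ} {v v' : V} (he : Edge E u v v') {x : OfHoms j₁ j₂ h₁ h₂}
    (hx : x ∈ reach h₁ h₂ M E v₀ v) : t ^ (u : ℤ) * x ∈ reach h₁ h₂ M E v₀ v' := by
  have hE' : ∀ z, side j₁ j₂ u z ∈ M v ↔ side j₁ j₂ (-u) z ∈ M v' := by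
    rcases Int.units_eq_one_or u with rfl | rfl
    · simpa [side] using hE _ _ (by simpa [Edge] using he)
    · intro z
      simpa [side] using (hE _ _ (by simpa [Edge] using he) z).symm
  obtain ⟨g, hg, l, hl, ha, rfl⟩ := hx
  by_cases hc : g ∈ (side j₁ j₂ u).range ∧ ∃ g' l', l = (-u, g') :: l'
  · obtain ⟨⟨z, rfl⟩, g', l', rfl⟩ := hc
    obtain ⟨w, hw, hg', ha'⟩ := ha
    have hww : w = v' := by
      replace hw := (edge_neg E u w v).1 hw
      rcases Int.units_eq_one_or u with rfl | rfl
      · exact hf _ _ _ (by simpa [Edge] using hw) (by simpa [Edge] using he)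
      · exact hi _ _ _ (by simpa [Edge] using hw) (by simpa [Edge] using he)
    subst hww
    refine ⟨side j₁ j₂ (-u) z * g', mul_mem ((hE' z).1 hg) hg', l', List.IsChain.tail hl, ha', ?_⟩
    rw [← mul_assoc, t_zpow_mul_of_side, wordProd_cons, map_mul]
    simp [mul_assoc]
  · refine ⟨1, one_mem _, (u, g) :: l, ?_, ⟨v, he, hg, ha⟩, by simp [mul_assoc]⟩
    rw [Reduced, List.isChain_cons]
    refine ⟨?_, hl⟩
    rintro ⟨u', g'⟩ hb hr
    by_contra hne
    refine hc ⟨hr, g', l.tail, ?_⟩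
    obtain ⟨l', rfl⟩ := List.head?_eq_some_iff.1 hb
    have : u' = -u := by
      have h : u ≠ u' := hne
      rcases Int.units_eq_one_or u with rfl | rfl <;>
        rcases Int.units_eq_one_or u' with rfl | rfl <;> simp_all
    simp [this]

theorem one_mem_reach : (1 : OfHoms j₁ j₂ h₁ h₂) ∈ reach h₁ h₂ M E v₀ v₀ :=
  ⟨1, one_mem _, [], List.isChain_nil, rfl, by simp⟩

theorem mem_of_of_mem_reach {g : K}
    (h : (of g : OfHoms j₁ j₂ h₁ h₂) ∈ reach h₁ h₂ M E v₀ v₀) : g ∈ M v₀ := by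
  obtain ⟨k, hk, l, hl, -, he⟩ := h
  obtain rfl := eq_nil_of_of_mul_wordProd_mem_range hl ⟨g, he⟩
  have : g = k := of_injective _ (by simpa using he)
  exact this ▸ hk

end Paths

theorem closure_subset_reach {M : Subgroup K} (hM : ∀ z, j₁ z ∈ M ↔ j₂ z ∈ M) :
    ∀ x ∈ Subgroup.closure (of '' (M : Set K) ∪ {(t : OfHoms j₁ j₂ h₁ h₂)}),
      x ∈ reach h₁ h₂ (fun _ : Unit => M) (fun _ _ => True) () () := by
  have ht : ∀ u : ℤˣ, ∀ x ∈ reach h₁ h₂ (fun _ : Unit => M) (fun _ _ => True) () (),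
      t ^ (u : ℤ) * x ∈ reach h₁ h₂ (fun _ : Unit => M) (fun _ _ => True) () () :=
    fun u x hx => t_zpow_mul_mem_reach (fun _ _ _ => hM) (fun _ _ _ _ _ => rfl)
      (fun _ _ _ _ _ => rfl) (by simp [Edge]) hx
  intro x hx
  induction hx using Subgroup.closure_induction_left with
  | one => exact one_mem_reach
  | mul_left x hx y _ ih =>
    rcases hx with ⟨g, hg, rfl⟩ | rfl
    · exact of_mul_mem_reach ih hg
    · simpa using ht 1 _ ih
  | inv_mul_cancel x hx y _ ih =>
    rcases hx with ⟨g, hg, rfl⟩ | rfl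
    · rw [← map_inv]
      exact of_mul_mem_reach ih (inv_mem hg)
    · simpa using ht (-1) _ ih

/-- A subgroup of the base group that is respected by the associated isomorphism is the
intersection of the base group with the subgroup it generates together with the stable letter. -/
theorem comap_closure_stable {M : Subgroup K} (hM : ∀ z, j₁ z ∈ M ↔ j₂ z ∈ M) :
    (Subgroup.closure (of '' (M : Set K) ∪ {t})).comap (of : K →* OfHoms j₁ j₂ h₁ h₂) = M := by
  refine le_antisymm (fun g hg => mem_of_of_mem_reach (closure_subset_reach hM _ hg)) fun g hg => ?_
  exact Subgroup.subset_closure (.inl ⟨g, hg, rfl⟩)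

theorem mem_of_of_mem_closure_conj {M₀ M₁ : Subgroup K} (hM : ∀ z, j₁ z ∈ M₁ ↔ j₂ z ∈ M₀) {g : K}
    (hg : (of g : OfHoms j₁ j₂ h₁ h₂) ∈
      Subgroup.closure (of '' (M₀ : Set K) ∪ (fun x => t * of x * t⁻¹) '' (M₁ : Set K))) :
    g ∈ M₀ := by
  let M : Bool → Subgroup K := fun b => cond b M₁ M₀
  let E : Bool → Bool → Prop := fun a b => a = true ∧ b = false
  have ht : ∀ u : ℤˣ, ∀ v v' : Bool, Edge E u v v' → ∀ x ∈ reach h₁ h₂ M E false v,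
      t ^ (u : ℤ) * x ∈ reach h₁ h₂ M E false v' := by
    refine fun u v v' he x hx => t_zpow_mul_mem_reach ?_ ?_ ?_ he hx
    · rintro _ _ ⟨rfl, rfl⟩
      exact hM
    · rintro _ _ _ ⟨rfl, rfl⟩ ⟨_, rfl⟩
      rfl
    · rintro _ _ _ ⟨rfl, rfl⟩ ⟨rfl, _⟩
      rfl
  have hc : ∀ g ∈ M₁, ∀ x ∈ reach h₁ h₂ M E false false,
      t * of g * t⁻¹ * x ∈ reach h₁ h₂ M E false false := by
    intro g hg x hx
    have h1 := ht (-1) false true (by simp [Edge, E]) x hx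
    have h2 := ht 1 true false (by simp [Edge, E]) _ (of_mul_mem_reach (g := g) h1 hg)
    simpa [mul_assoc] using h2
  suffices h : ∀ x ∈ Subgroup.closure
      (of '' (M₀ : Set K) ∪ (fun x => t * of x * t⁻¹) '' (M₁ : Set K)),
      x ∈ reach h₁ h₂ M E false false from
    mem_of_of_mem_reach (M := M) (h _ hg)
  intro x hx
  induction hx using Subgroup.closure_induction_left with
  | one => exact one_mem_reach
  | mul_left x hx y _ ih =>
    rcases hx with ⟨g, hg, rfl⟩ | ⟨g, hg, rfl⟩
    · exact of_mul_mem_reach ih hg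
    · exact hc g hg _ ih
  | inv_mul_cancel x hx y _ ih =>
    rcases hx with ⟨g, hg, rfl⟩ | ⟨g, hg, rfl⟩
    · rw [← map_inv]
      exact of_mul_mem_reach ih (inv_mem hg)
    · simpa [mul_assoc] using hc g⁻¹ (inv_mem hg) _ ih

theorem closure_of_t : Subgroup.closure
    ((of : K →* OfHoms j₁ j₂ h₁ h₂) '' Set.univ ∪ {t}) = ⊤ := by
  refine eq_top_iff.2 fun x _ => ?_
  induction x using induction_on with
  | of g => exact Subgroup.subset_closure (.inl ⟨g, trivial, rfl⟩)
  | t => exact Subgroup.subset_closure (.inr rfl)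
  | mul x y hx hy => exact mul_mem (hx trivial) (hy trivial)
  | inv x hx => exact inv_mem (hx trivial)

theorem exists_reduced (x : OfHoms j₁ j₂ h₁ h₂) :
    ∃ g l, Reduced j₁ j₂ l ∧ x = of g * wordProd h₁ h₂ l := by
  have := closure_subset_reach (h₁ := h₁) (h₂ := h₂) (M := ⊤) (by simp)
  rw [Subgroup.coe_top, closure_of_t] at this
  obtain ⟨g, -, l, hl, -, h⟩ := this x (Subgroup.mem_top x)
  exact ⟨g, l, hl, h⟩

theorem wordProd_flatten_replicate (l : List (ℤˣ × K)) (n : ℕ) :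
    wordProd h₁ h₂ (List.replicate n l).flatten = wordProd h₁ h₂ l ^ n := by
  induction n with
  | zero => simp
  | succ n ih => simp [List.replicate_succ, pow_succ', ih]

theorem reduced_flatten_replicate {l : List (ℤˣ × K)} (hl : Reduced j₁ j₂ l)
    (hc : ∀ a ∈ l.getLast?, ∀ b ∈ l.head?, a.2 ∈ (side j₁ j₂ a.1).range → a.1 = b.1) (n : ℕ) :
    Reduced j₁ j₂ (List.replicate n l).flatten := by
  rcases eq_or_ne l [] with rfl | hne
  · simp [Reduced]
  · unfold Reduced
    rw [List.isChain_flatten]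
    · refine ⟨fun l' h => (List.eq_of_mem_replicate h) ▸ hl, ?_⟩
      exact List.isChain_replicate_of_rel n hc
    · intro h
      exact hne (List.eq_of_mem_replicate h).symm

/-- Every element of finite order of an HNN extension is conjugate into the base group. -/
theorem exists_conj_of_pow_eq_one {x : OfHoms j₁ j₂ h₁ h₂} {n : ℕ} (hn : 0 < n) (hx : x ^ n = 1) :
    ∃ c k, x = c * of k * c⁻¹ := by
  obtain ⟨g, l, hl, rfl⟩ := exists_reduced x
  induction hm : l.length using Nat.strong_induction_on generalizing g l with
  | _ m ih =>
    subst hm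
    rcases List.eq_nil_or_concat l with rfl | ⟨l', a, rfl⟩
    · exact ⟨1, g, by simp⟩
    rw [List.concat_eq_append] at *
    obtain ⟨u, h⟩ := a
    set r : List (ℤˣ × K) := l' ++ [(u, h * g)] with hr
    have hconj : of g * wordProd h₁ h₂ (l' ++ [(u, h)]) = of g * wordProd h₁ h₂ r * (of g)⁻¹ := by
      simp [hr, mul_assoc]
    have hrn : wordProd h₁ h₂ r ^ n = 1 := by
      rw [hconj, conj_pow] at hx
      simpa using hx
    by_cases hcyc : ∀ b ∈ r.head?, (h * g) ∈ (side j₁ j₂ u).range → u = b.1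
    · by_cases hred : Reduced j₁ j₂ r
      · exfalso
        have h1 := reduced_flatten_replicate hred (by simpa [hr] using hcyc) n
        have h2 := eq_nil_of_of_mul_wordProd_mem_range (h₁ := h₁) (h₂ := h₂) (g := 1) h1
          ⟨1, by rw [wordProd_flatten_replicate, hrn]; simp⟩
        rw [List.flatten_eq_nil_iff] at h2
        have := h2 r (List.mem_replicate.2 ⟨hn.ne', rfl⟩)
        simp [hr] at this
      · refine absurd ?_ hred
        unfold Reduced at hl ⊢
        rw [List.isChain_append] at hl ⊢
        refine ⟨hl.1, by simp, ?_⟩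
        intro p hp q hq
        have := hl.2.2 p hp (u, h) (by simp)
        simp at hq
        simpa [← hq] using this
    · push Not at hcyc
      obtain ⟨⟨u', k⟩, hb, ⟨z, hz⟩, hne⟩ := hcyc
      have hu : u' = -u := by
        have h : u ≠ u' := hne
        rcases Int.units_eq_one_or u with rfl | rfl <;>
          rcases Int.units_eq_one_or u' with rfl | rfl <;> simp_all
      subst hu
      cases l' with
      | nil =>
        simp [hr] at hb
      | cons b l'' =>
        simp [hr] at hb
        subst hb
        have key : wordProd h₁ h₂ r = (t ^ (u : ℤ))⁻¹ *
            (of k * wordProd h₁ h₂ l'' * of (side j₁ j₂ (-u) z)) * t ^ (u : ℤ) := by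
          have := t_zpow_mul_of_side (h₁ := h₁) (h₂ := h₂) u z
          simp [hr, mul_assoc, ← hz, this]
        have key2 : of k * wordProd h₁ h₂ l'' * of (side j₁ j₂ (-u) z) =
            (of (side j₁ j₂ (-u) z))⁻¹ * (of (side j₁ j₂ (-u) z * k) * wordProd h₁ h₂ l'') *
              of (side j₁ j₂ (-u) z) := by
          simp [mul_assoc]
        have hl'' : Reduced j₁ j₂ l'' := by
          unfold Reduced at hl ⊢
          rw [List.isChain_append] at hl
          exact hl.1.tail
        have hp : (of (side j₁ j₂ (-u) z * k) * wordProd h₁ h₂ l'') ^ n = 1 := by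
          rw [key, key2] at hrn
          have e : ∀ (a b c : OfHoms j₁ j₂ h₁ h₂), a⁻¹ * (b⁻¹ * c * b) * a =
              (b * a)⁻¹ * c * ((b * a)⁻¹)⁻¹ := by
            intro a b c
            group
          rw [e, conj_pow] at hrn
          simpa [mul_eq_one_iff_eq_inv] using hrn
        obtain ⟨c, k', hck⟩ := ih l''.length (by simp) _ l'' hl'' hp rfl
        rw [hconj, key, key2, hck]
        exact ⟨of g * (t ^ (u : ℤ))⁻¹ * (of (side j₁ j₂ (-u) z))⁻¹ * c, k', by group⟩

end OfHoms

end HNNExtension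

open HNNExtension

/-- Only the identity element has finite order. -/
def NoTorsion (G : Type*) [Group G] : Prop := ∀ (g : G) (n : ℕ), 0 < n → g ^ n = 1 → g = 1

theorem Group.IsFinitelyPresented.of_section {G H : Type*} [Group G] [Group H]
    [IsFinitelyPresented G] (f : G →* H) (hf : Function.Surjective f) {S : Set G} (hS : S.Finite)
    (hfS : ∀ s ∈ S, f s = 1) (g : H →* G ⧸ Subgroup.normalClosure S)
    (hg : ∀ x, g (f x) = x) : IsFinitelyPresented H := by
  refine of_surjective f hf ⟨S, hS, le_antisymm (Subgroup.normalClosure_le_normal hfS) ?_⟩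
  intro x hx
  rw [MonoidHom.mem_ker] at hx
  have := hg x
  rw [hx, map_one] at this
  exact (QuotientGroup.eq_one_iff x).1 this.symm

theorem Group.IsFinitelyPresented.fg {G : Type*} [Group G] [h : IsFinitelyPresented G] :
    Group.FG G := by
  obtain ⟨n, f, hf, -⟩ := h.out
  exact Group.fg_of_surjective hf

namespace HNNExtension.OfHoms

variable {K Z : Type*} [Group K] [Group Z] {j₁ j₂ : Z →* K} {h₁ : Function.Injective j₁}
  {h₂ : Function.Injective j₂}

theorem noTorsion (hK : NoTorsion K) : NoTorsion (OfHoms j₁ j₂ h₁ h₂) := by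
  intro x n hn hx
  obtain ⟨c, k, rfl⟩ := exists_conj_of_pow_eq_one hn hx
  rw [conj_pow, conj_eq_one_iff, ← map_pow, map_eq_one_iff _ (of_injective _)] at hx
  simp [hK k n hn hx]

theorem isFinitelyPresented [Group.IsFinitelyPresented K] [hZ : Group.FG Z] :
    Group.IsFinitelyPresented (OfHoms j₁ j₂ h₁ h₂) := by
  obtain ⟨T, hT⟩ := hZ.out
  let x : Monoid.Coprod K (FreeGroup Unit) := Monoid.Coprod.inr (FreeGroup.of ())
  let r : Z → Monoid.Coprod K (FreeGroup Unit) := fun z =>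
    x * .inl (j₁ z) * x⁻¹ * (.inl (j₂ z))⁻¹
  let f : Monoid.Coprod K (FreeGroup Unit) →* OfHoms j₁ j₂ h₁ h₂ :=
    Monoid.Coprod.lift of (FreeGroup.lift fun _ => t)
  let q := QuotientGroup.mk' (Subgroup.normalClosure (r '' (T : Set Z)))
  have hx : ∀ z, q x * q (.inl (j₁ z)) = q (.inl (j₂ z)) * q x := by
    have h : ((MulAut.conj (q x)).toMonoidHom.comp (q.comp Monoid.Coprod.inl)).comp j₁ =
        (q.comp Monoid.Coprod.inl).comp j₂ := by
      refine MonoidHom.eq_of_eqOn_dense hT fun z hz => ?_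
      have : q (r z) = 1 := (QuotientGroup.eq_one_iff _).2
        (Subgroup.subset_normalClosure ⟨z, hz, rfl⟩)
      simp only [r, map_mul, map_inv] at this
      simpa using mul_inv_eq_one.1 this
    intro z
    have := DFunLike.congr_fun h z
    simp only [MonoidHom.comp_apply, MulEquiv.coe_toMonoidHom, MulAut.conj_apply] at this
    exact (mul_inv_eq_iff_eq_mul.1 this)
  refine Group.IsFinitelyPresented.of_section f ?_ (S := r '' (T : Set Z))
    (T.finite_toSet.image _) ?_ (desc h₁ h₂ (q.comp Monoid.Coprod.inl) (q x) hx) ?_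
  · rw [← MonoidHom.range_eq_top, eq_top_iff, ← closure_of_t, Subgroup.closure_le]
    rintro _ (⟨k, -, rfl⟩ | rfl)
    · exact ⟨.inl k, by simp [f]⟩
    · exact ⟨x, by simp [f, x]⟩
  · rintro _ ⟨z, -, rfl⟩
    simp [f, r, x, t_mul_of_left]
  · refine DFunLike.congr_fun (f := (desc h₁ h₂ (q.comp Monoid.Coprod.inl) (q x) hx).comp f)
      (g := q) ?_
    ext <;> simp [f, x]

end HNNExtension.OfHoms

/-- Iterated HNN extensions realising finitely many partial isomorphisms of a group. -/
theorem exists_iterated_hnnExtension {G Z : Type} [Group G] [Group Z]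
    [Group.IsFinitelyPresented G] (hG : NoTorsion G) [Group.FG Z]
    (l : List ((Z →* G) × (Z →* G)))
    (hl : ∀ r ∈ l, Function.Injective r.1 ∧ Function.Injective r.2) :
    ∃ (K : Type) (_ : Group K) (i : G →* K) (T : Finset K), Group.IsFinitelyPresented K ∧
      NoTorsion K ∧ Function.Injective i ∧
      (∀ r ∈ l, ∃ s ∈ T, ∀ z, s * i (r.1 z) = i (r.2 z) * s) ∧
      ∀ L : Subgroup G, (∀ r ∈ l, ∀ z, r.1 z ∈ L ↔ r.2 z ∈ L) →
        (Subgroup.closure (i '' (L : Set G) ∪ T)).comap i = L := by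
  classical
  induction l with
  | nil =>
    refine ⟨G, inferInstance, MonoidHom.id G, ∅, inferInstance, hG, Function.injective_id,
      by simp, fun L _ => by ext; simp⟩
  | cons r l ih =>
    obtain ⟨K, _, i, T, _, hK, hi, hs, hL⟩ := ih fun r hr => hl r (List.mem_cons_of_mem _ hr)
    obtain ⟨hr₁, hr₂⟩ := hl r List.mem_cons_self
    have h₁ : Function.Injective (i.comp r.1) := hi.comp hr₁
    have h₂ : Function.Injective (i.comp r.2) := hi.comp hr₂
    refine ⟨OfHoms _ _ h₁ h₂, inferInstance, of.comp i, insert t (T.image of),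
      OfHoms.isFinitelyPresented, OfHoms.noTorsion hK, (of_injective _).comp hi, ?_, ?_⟩
    · intro r' hr'
      rcases List.mem_cons.1 hr' with rfl | hr'
      · exact ⟨t, by simp, OfHoms.t_mul_of_left⟩
      · obtain ⟨s, hsT, hs⟩ := hs r' hr'
        refine ⟨of s, Finset.mem_insert_of_mem (Finset.mem_image_of_mem _ hsT), fun z => ?_⟩
        simp [← map_mul, hs z]
    · intro L hLr
      have hL' := hL L fun r hr => hLr r (List.mem_cons_of_mem _ hr)
      have hcomap := OfHoms.comap_closure_stable (h₁ := h₁) (h₂ := h₂)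
        (M := Subgroup.closure (i '' (L : Set G) ∪ T)) (by
          intro z
          have := hLr r List.mem_cons_self z
          rw [← hL'] at this
          simpa using this)
      refine le_antisymm ?_ fun g hg => Subgroup.subset_closure (.inl ⟨g, hg, rfl⟩)
      rw [← hL', ← Subgroup.comap_comap]
      refine Subgroup.comap_mono ?_
      rw [hL'] 
      conv_rhs => rw [← hcomap]
      refine Subgroup.comap_mono ?_
      rw [Subgroup.closure_le]
      rintro _ (⟨g, hg, rfl⟩ | hx)
      · exact Subgroup.subset_closure (.inl ⟨i g, Subgroup.subset_closure (.inl ⟨g, hg, rfl⟩), rfl⟩)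
      · rw [Finset.coe_insert, Set.mem_insert_iff] at hx
        rcases hx with rfl | hx
        · exact Subgroup.subset_closure (.inr rfl)
        · rw [Finset.coe_image] at hx
          obtain ⟨s, hs, rfl⟩ := hx
          exact Subgroup.subset_closure (.inl ⟨s, Subgroup.subset_closure (.inr hs), rfl⟩)

/-- The free group on `P`-many copies of an alphabet consisting of `none`, `some none` and the
letters of `B`. -/
abbrev ShiftFree (P B : Type) : Type := FreeGroup (P × Option (Option B))

namespace ShiftFree

variable {P B : Type}

/-- The letter marking the index of a configuration. -/
def t (p : P) : ShiftFree P B := FreeGroup.of (p, none)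

/-- The separating letter. -/
def d (p : P) : ShiftFree P B := FreeGroup.of (p, some none)

/-- The `p`-th copy of the free group on `B`. -/
def word (p : P) : FreeGroup B →* ShiftFree P B := FreeGroup.map fun i => (p, some (some i))

theorem hom_ext {H : Type*} [Group H] {f g : ShiftFree P B →* H} (ht : ∀ p, f (t p) = g (t p))
    (hd : ∀ p, f (d p) = g (d p))
    (hb : ∀ p i, f (word p (FreeGroup.of i)) = g (word p (FreeGroup.of i))) : f = g := by
  refine FreeGroup.ext_hom _ _ ?_
  rintro ⟨p, _ | _ | i⟩
  · exact ht p
  · exact hd p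
  · simpa [word] using hb p i

/-- The homomorphism with prescribed values on letters. -/
def lift {H : Type*} [Group H] (ft fd : P → H) (fb : P → B → H) : ShiftFree P B →* H :=
  FreeGroup.lift fun x => match x with
    | (p, none) => ft p
    | (p, some none) => fd p
    | (p, some (some i)) => fb p i

section
variable {H : Type*} [Group H] (ft fd : P → H) (fb : P → B → H)

@[simp] theorem lift_t (p : P) : lift ft fd fb (t p) = ft p := by simp [lift, t]

@[simp] theorem lift_d (p : P) : lift ft fd fb (d p) = fd p := by simp [lift, d]

@[simp] theorem lift_word (p : P) (w : FreeGroup B) :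
    lift ft fd fb (word p w) = FreeGroup.lift (fb p) w := by
  refine DFunLike.congr_fun (f := (lift ft fd fb).comp (word p)) (g := FreeGroup.lift (fb p)) ?_ w
  ext; simp [lift, word]

end

theorem lift_word_eq (q : P) (w : FreeGroup B) :
    FreeGroup.lift (fun i => word q (FreeGroup.of i)) w = (word q w : ShiftFree P B) := by
  refine DFunLike.congr_fun (g := word q) ?_ w
  ext; simp

variable [Group P]

/-- Left translation of the indices. -/
def shift (P B : Type) [Group P] : P →* MulAut (ShiftFree P B) where
  toFun p := FreeGroup.freeGroupCongr ((Equiv.mulLeft p).prodCongr (Equiv.refl _))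
  map_one' := by
    refine MulEquiv.toMonoidHom_injective (FreeGroup.ext_hom _ _ fun x => ?_)
    simp
  map_mul' p q := by
    refine MulEquiv.toMonoidHom_injective (FreeGroup.ext_hom _ _ fun x => ?_)
    simp [Prod.map, mul_assoc]

@[simp] theorem shift_of (p : P) (x : P × Option (Option B)) :
    shift P B p (FreeGroup.of x) = FreeGroup.of (p * x.1, x.2) := by
  simp [shift, Prod.map]

@[simp] theorem shift_t (p q : P) : shift P B p (t q) = t (p * q) := by simp [t]

@[simp] theorem shift_d (p q : P) : shift P B p (d q) = d (p * q) := by simp [d]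

@[simp] theorem shift_word (p q : P) (w : FreeGroup B) :
    shift P B p (word q w) = word (p * q) w := by
  refine DFunLike.congr_fun (f := ((shift P B p).toMonoidHom.comp (word q)))
    (g := word (p * q)) ?_ w
  ext; simp [word]

/-- Reindexing of indices along `α`, the letters `t` being translated by `p₀`. -/
def reindex (α : P →* P) (p₀ : P) : ShiftFree P B →* ShiftFree P B :=
  lift (fun p => t (α p * p₀)) (fun p => d (α p)) fun p i => word (α p) (FreeGroup.of i)

/-- The map inserting `g` before every letter `d`. -/
def insert (P : Type) [Group P] (g : FreeGroup B) : ShiftFree P B →* ShiftFree P B :=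
  lift t (fun p => word p g * d p) fun p i => word p (FreeGroup.of i)

@[simp] theorem reindex_t (α : P →* P) (p₀ p : P) :
    reindex (B := B) α p₀ (t p) = t (α p * p₀) := by simp [reindex]

@[simp] theorem reindex_d (α : P →* P) (p₀ p : P) :
    reindex (B := B) α p₀ (d p) = d (α p) := by simp [reindex]

@[simp] theorem reindex_word (α : P →* P) (p₀ p : P) (w : FreeGroup B) :
    reindex α p₀ (word p w) = word (α p) w := by simp [reindex, lift_word_eq]

@[simp] theorem insert_t (g : FreeGroup B) (p : P) : insert P g (t p) = t p := by simp [insert]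

@[simp] theorem insert_d (g : FreeGroup B) (p : P) : insert P g (d p) = word p g * d p := by
  simp [insert]

@[simp] theorem insert_word (g : FreeGroup B) (p : P) (w : FreeGroup B) :
    insert P g (word p w) = word p w := by simp [insert, lift_word_eq]

theorem insert_inv_insert (g : FreeGroup B) (x : ShiftFree P B) :
    insert P g⁻¹ (insert P g x) = x := by
  refine DFunLike.congr_fun (f := (insert P g⁻¹).comp (insert P g)) (g := MonoidHom.id _) ?_ x
  refine hom_ext ?_ ?_ ?_ <;> simp

theorem insert_injective (g : FreeGroup B) : Function.Injective (insert P g) :=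
  Function.LeftInverse.injective (insert_inv_insert g)

theorem reindex_injective {α : P →* P} (hα : Function.Injective α) (p₀ : P) :
    Function.Injective (reindex (B := B) α p₀) := by
  let θ : P × Option (Option B) → P × Option (Option B)
    | (p, none) => (α p * p₀, none)
    | (p, some x) => (α p, some x)
  have hθ : Function.Injective θ := by
    rintro ⟨p, _ | x⟩ ⟨q, _ | y⟩ h <;> simp [θ, hα.eq_iff] at h <;> simp [h]
  have : reindex (B := B) α p₀ = FreeGroup.map θ := by
    refine hom_ext ?_ ?_ ?_ <;> intros <;> simp <;> simp [t, d, word, θ]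
  rw [this]
  exact FreeGroup.map_injective hθ

theorem reindex_shift (α : P →* P) (p₀ p : P) :
    (reindex (B := B) α p₀).comp (shift P B p).toMonoidHom =
      (shift P B (α p)).toMonoidHom.comp (reindex α p₀) := by
  refine hom_ext ?_ ?_ ?_ <;> simp [mul_assoc]

theorem insert_shift (g : FreeGroup B) (p : P) :
    (insert P g).comp (shift P B p).toMonoidHom =
      (shift P B p).toMonoidHom.comp (insert P g) := by
  refine hom_ext ?_ ?_ ?_ <;> simp

/-- The element coding a configuration. -/
def code (c : P × FreeGroup B) : ShiftFree P B := word 1 c.2 * d 1 * t c.1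

/-- The subgroup coding a set of configurations. -/
def codeSubgroup (U : Subgroup (FreeGroup B)) (C : Set (P × FreeGroup B)) :
    Subgroup (ShiftFree P B) :=
  Subgroup.closure (word 1 '' (U : Set (FreeGroup B)) ∪ code '' C)

variable {U : Subgroup (FreeGroup B)} {C : Set (P × FreeGroup B)}

theorem word_mem_codeSubgroup {w : FreeGroup B} (hw : w ∈ U) : word 1 w ∈ codeSubgroup U C :=
  Subgroup.subset_closure (.inl ⟨w, hw, rfl⟩)

theorem code_mem_codeSubgroup {c} (hc : c ∈ C) : code c ∈ codeSubgroup U C :=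
  Subgroup.subset_closure (.inr ⟨c, hc, rfl⟩)

theorem codeSubgroup_le {M : Subgroup (ShiftFree P B)} (hU : ∀ w ∈ U, word 1 w ∈ M)
    (hC : ∀ c ∈ C, code c ∈ M) : codeSubgroup U C ≤ M := by
  rw [codeSubgroup, Subgroup.closure_le]
  rintro _ (⟨w, hw, rfl⟩ | ⟨c, hc, rfl⟩)
  exacts [hU w hw, hC c hc]

theorem comap_insert (g : FreeGroup B) : (codeSubgroup U C).comap (insert P g) =
    codeSubgroup U ((fun c : P × FreeGroup B => (c.1, c.2 * g)) ⁻¹' C) := by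
  have key (g : FreeGroup B) (D : Set (P × FreeGroup B)) :
      codeSubgroup U ((fun c : P × FreeGroup B => (c.1, c.2 * g)) ⁻¹' D) ≤
        (codeSubgroup U D).comap (insert P g) := by
    refine codeSubgroup_le (fun w hw => by simpa using word_mem_codeSubgroup hw) fun c hc => ?_
    have := code_mem_codeSubgroup (U := U) (C := D) hc
    simpa [code, mul_assoc] using this
  refine le_antisymm (fun x hx => ?_) (key g C)
  have h := key g⁻¹ ((fun c : P × FreeGroup B => (c.1, c.2 * g)) ⁻¹' C)
  simp only [Set.preimage_preimage, inv_mul_cancel_right, Prod.mk.eta, Set.preimage_id'] at h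
  have := h hx
  rwa [Subgroup.mem_comap, insert_inv_insert] at this

theorem comap_reindex (hC : ∀ p w w', (p, w) ∈ C → (p, w') ∈ C → w * w'⁻¹ ∈ U)
    {α : P →* P} (hα : Function.Injective α) (p₀ : P) :
    (codeSubgroup U C).comap (reindex α p₀) =
      codeSubgroup U ((fun c : P × FreeGroup B => (α c.1 * p₀, c.2)) ⁻¹' C) := by
  classical
  set D := (fun c : P × FreeGroup B => (α c.1 * p₀, c.2)) ⁻¹' C with hD
  let κ : ShiftFree P B →* ShiftFree P B := lift
    (fun p => if h : ∃ q, α q * p₀ = p then t h.choose else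
      if h : ∃ w, (p, w) ∈ C then (d 1)⁻¹ * (word 1 h.choose)⁻¹ else 1)
    (fun p => if h : ∃ q, α q = p then d h.choose else 1)
    (fun p i => if h : ∃ q, α q = p then word h.choose (FreeGroup.of i) else 1)
  have ht (p : P) : κ (t (α p * p₀)) = t p := by
    have h : ∃ q, α q * p₀ = α p * p₀ := ⟨p, rfl⟩
    simp only [κ, lift_t]
    rw [dif_pos h, hα (mul_right_cancel h.choose_spec)]
  have hd (p : P) : κ (d (α p)) = d p := by
    have h : ∃ q, α q = α p := ⟨p, rfl⟩
    simp only [κ, lift_d]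
    rw [dif_pos h, hα h.choose_spec]
  have hw (p : P) (w) : κ (word (α p) w) = word p w := by
    have h : ∃ q, α q = α p := ⟨p, rfl⟩
    simp only [κ, lift_word]
    rw [← lift_word_eq]
    congr 2
    funext i
    rw [dif_pos h, hα h.choose_spec]
  have hκ (x) : κ (reindex α p₀ x) = x := by
    refine DFunLike.congr_fun (f := κ.comp (reindex α p₀)) (g := MonoidHom.id _) ?_ x
    refine hom_ext ?_ ?_ ?_ <;> simp [ht, hd, hw]
  have hd1 : κ (d 1) = d 1 := by simpa using hd 1
  have hw1 (w) : κ (word 1 w) = word 1 w := by simpa using hw 1 w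
  apply le_antisymm
  · have h : codeSubgroup U C ≤ (codeSubgroup U D).comap κ := by
      refine codeSubgroup_le (fun w h => ?_) fun c hc => ?_
      · rw [Subgroup.mem_comap, hw1]
        exact word_mem_codeSubgroup h
      · rw [Subgroup.mem_comap, code, map_mul, map_mul, hw1, hd1]
        by_cases h : ∃ q, α q * p₀ = c.1
        · obtain ⟨q, hq⟩ := h
          rw [← hq, ht]
          exact code_mem_codeSubgroup (c := (q, c.2)) (by simpa [hD, hq] using hc)
        · have h' : ∃ w, (c.1, w) ∈ C := ⟨c.2, hc⟩
          have : κ (t c.1) = (d 1)⁻¹ * (word 1 h'.choose)⁻¹ := by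
            simp only [κ, lift_t]
            rw [dif_neg h, dif_pos h']
          rw [this]
          have := word_mem_codeSubgroup (C := D) (hC _ _ _ hc h'.choose_spec)
          simpa [mul_assoc] using this
    intro x hx
    simpa [hκ] using h hx
  · refine codeSubgroup_le (fun w hw => by simpa using word_mem_codeSubgroup hw) fun c hc => ?_
    have := code_mem_codeSubgroup (U := U) (C := C) hc
    simpa [code, mul_assoc] using this

theorem comap_word (hC : ∀ p w w', (p, w) ∈ C → (p, w') ∈ C → w * w'⁻¹ ∈ U) :
    (codeSubgroup U C).comap (word (1 : P)) = U := by
  classical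
  let κ : ShiftFree P B →* FreeGroup B := lift
    (fun p => if h : ∃ w, (p, w) ∈ C then h.choose⁻¹ else 1) 1 fun _ => FreeGroup.of
  have hw (w) : κ (word 1 w) = w := by
    simp only [κ, lift_word]
    exact DFunLike.congr_fun (f := FreeGroup.lift FreeGroup.of) (g := MonoidHom.id _)
      (by ext; simp) w
  refine le_antisymm (fun w h => ?_) fun w h => word_mem_codeSubgroup h
  have h' : codeSubgroup U C ≤ U.comap κ := by
    refine codeSubgroup_le (fun w h => by simpa [hw] using h) fun c hc => ?_
    have h' : ∃ w, (c.1, w) ∈ C := ⟨c.2, hc⟩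
    have : κ (t c.1) = h'.choose⁻¹ := by simp only [κ, lift_t]; rw [dif_pos h']
    rw [Subgroup.mem_comap, code, map_mul, map_mul, hw, this]
    simpa [κ] using hC _ _ _ hc h'.choose_spec
  simpa [hw] using h' h

theorem isFinitelyPresented_semidirect [Finite B] [Group.IsFinitelyPresented P] :
    Group.IsFinitelyPresented (ShiftFree P B ⋊[shift P B] P) := by
  let u : FreeGroup (Option (Option B)) →* ShiftFree P B := FreeGroup.map fun x => (1, x)
  let f : Monoid.Coprod P (FreeGroup (Option (Option B))) →* ShiftFree P B ⋊[shift P B] P :=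
    Monoid.Coprod.lift SemidirectProduct.inr (SemidirectProduct.inl.comp u)
  let g : ShiftFree P B ⋊[shift P B] P →* Monoid.Coprod P (FreeGroup (Option (Option B))) :=
    SemidirectProduct.lift (FreeGroup.lift fun x =>
      .inl x.1 * .inr (FreeGroup.of x.2) * .inl x.1⁻¹) Monoid.Coprod.inl (by
        intro p
        ext x
        simp [mul_assoc])
  refine Group.IsFinitelyPresented.equiv (MonoidHom.toMulEquiv f g ?_ ?_)
  · ext <;> simp [f, g, u]
  · refine SemidirectProduct.hom_ext ?_ ?_
    · ext x
      · simp [f, g, u]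
      · simp [f, g, u]
    · ext x <;> simp [f, g]

theorem noTorsion_semidirect (hP : NoTorsion P) : NoTorsion (ShiftFree P B ⋊[shift P B] P) := by
  intro x n hn hx
  have h : x.right = 1 := hP _ n hn (by
    have := congrArg SemidirectProduct.rightHom hx
    rwa [map_pow, map_one] at this)
  obtain ⟨y, rfl⟩ : ∃ y, x = SemidirectProduct.inl y := ⟨x.left, by ext <;> simp [h]⟩
  rw [← map_pow, map_eq_one_iff _ SemidirectProduct.inl_injective,
    pow_eq_one_iff_left hn.ne'] at hx
  simp [hx]

variable {α : P →* P} (p₀ : P) (g : FreeGroup B)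

/-- The endomorphism of the semidirect product induced by `α` and a translation. -/
def reindexSemi (α : P →* P) : ShiftFree P B ⋊[shift P B] P →* ShiftFree P B ⋊[shift P B] P :=
  SemidirectProduct.map (reindex α p₀) α (reindex_shift α p₀)

/-- The endomorphism of the semidirect product inserting `g` before every letter `d`. -/
def insertSemi : ShiftFree P B ⋊[shift P B] P →* ShiftFree P B ⋊[shift P B] P :=
  SemidirectProduct.map (insert P g) (MonoidHom.id P) (insert_shift g)

@[simp] theorem reindexSemi_inl (α : P →* P) (x : ShiftFree P B) :
    reindexSemi p₀ α (SemidirectProduct.inl x) = SemidirectProduct.inl (reindex α p₀ x) :=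
  SemidirectProduct.map_inl _ _ _ _

@[simp] theorem insertSemi_inl (x : ShiftFree P B) :
    insertSemi g (SemidirectProduct.inl x) = SemidirectProduct.inl (insert P g x) :=
  SemidirectProduct.map_inl _ _ _ _

theorem reindexSemi_injective (hα : Function.Injective α) :
    Function.Injective (reindexSemi (B := B) p₀ α) := by
  intro x y h
  ext
  · exact reindex_injective hα p₀ (congrArg SemidirectProduct.left h)
  · exact hα (congrArg SemidirectProduct.right h)

theorem insertSemi_injective : Function.Injective (insertSemi (P := P) g) := by
  intro x y h
  ext
  · exact insert_injective g (congrArg SemidirectProduct.left h)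
  · have : (insertSemi g x).right = (insertSemi g y).right := congrArg SemidirectProduct.right h
    exact this

theorem mem_map_inl {L : Subgroup (ShiftFree P B)} {x : ShiftFree P B ⋊[shift P B] P} :
    x ∈ L.map SemidirectProduct.inl ↔ x.left ∈ L ∧ x.right = 1 := by
  constructor
  · rintro ⟨y, hy, rfl⟩
    exact ⟨hy, rfl⟩
  · rintro ⟨h₁, h₂⟩
    exact ⟨_, h₁, by ext <;> simp [h₂]⟩

end ShiftFree

/-- A rewriting rule `(α y * p₀, w) → (β y * q₀, w * g)` on configurations. -/
structure AffineRule (P B : Type) [Group P] where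
  /-- the domain parametrisation -/
  α : P →* P
  /-- the codomain parametrisation -/
  β : P →* P
  /-- the domain offset -/
  p₀ : P
  /-- the codomain offset -/
  q₀ : P
  /-- the output -/
  g : FreeGroup B
  α_injective : Function.Injective α
  β_injective : Function.Injective β

/-- One rewriting step. -/
def AffineRule.Step {P B : Type} [Group P] (rules : List (AffineRule P B))
    (c c' : P × FreeGroup B) : Prop :=
  ∃ r ∈ rules, ∃ y w, c = (r.α y * r.p₀, w) ∧ c' = (r.β y * r.q₀, w * r.g)

namespace AffineRule

open Relation ShiftFree

variable {P B : Type} [Group P] {rules : List (AffineRule P B)}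

theorem eqvGen_mul_left (v : FreeGroup B) {c c' : P × FreeGroup B}
    (h : EqvGen (Step rules) c c') :
    EqvGen (Step rules) (c.1, v * c.2) (c'.1, v * c'.2) := by
  induction h with
  | rel c c' h =>
    obtain ⟨r, hr, y, w, rfl, rfl⟩ := h
    exact .rel _ _ ⟨r, hr, y, v * w, rfl, by simp [mul_assoc]⟩
  | refl => exact .refl _
  | symm _ _ _ ih => exact ih.symm
  | trans _ _ _ _ _ ih₁ ih₂ => exact ih₁.trans _ _ _ ih₂

/-- The outputs of the loops at a base point. -/
def loops (rules : List (AffineRule P B)) (base : P) : Subgroup (FreeGroup B) where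
  carrier := {w | EqvGen (Step rules) (base, 1) (base, w)}
  one_mem' := .refl _
  mul_mem' {a b} ha hb := by
    have := eqvGen_mul_left a hb
    simp only [mul_one] at this
    exact ha.trans _ _ _ this
  inv_mem' {a} ha := by
    have := eqvGen_mul_left a⁻¹ ha
    simp only [mul_one, inv_mul_cancel] at this
    exact this.symm

theorem exists_fg_comap_eq_loops [Group.IsFinitelyPresented P] (hP : NoTorsion P) [Finite B]
    (rules : List (AffineRule P B)) (base : P) :
    ∃ (K : Type) (_ : Group K) (i : FreeGroup B →* K) (L : Subgroup K),
      Group.IsFinitelyPresented K ∧ NoTorsion K ∧ Function.Injective i ∧ L.FG ∧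
        L.comap i = loops rules base := by
  classical
  set U := loops rules base with hU
  let C : Set (P × FreeGroup B) := {c | EqvGen (Step rules) (base, 1) c}
  have hC : ∀ p w w', (p, w) ∈ C → (p, w') ∈ C → w * w'⁻¹ ∈ U := by
    intro p w w' h h'
    have := eqvGen_mul_left (w * w'⁻¹) h'
    simp only [mul_one, inv_mul_cancel_right] at this
    exact h.trans _ _ _ this.symm
  let G := ShiftFree P B ⋊[shift P B] P
  have hG : Group.IsFinitelyPresented G := isFinitelyPresented_semidirect
  have hfg : Group.FG G := Group.IsFinitelyPresented.fg
  let Φ (r : AffineRule P B) : (G →* G) × (G →* G) :=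
    (reindexSemi r.p₀ r.α, (reindexSemi r.q₀ r.β).comp (insertSemi r.g))
  obtain ⟨K, _, i, T, hK, hKt, hi, hT, hL⟩ := exists_iterated_hnnExtension
    (noTorsion_semidirect (B := B) hP) (rules.map Φ) (by
      simp only [List.mem_map, forall_exists_index, and_imp, forall_apply_eq_imp_iff₂]
      intro r _
      exact ⟨reindexSemi_injective _ r.α_injective,
        (reindexSemi_injective _ r.β_injective).comp (insertSemi_injective _)⟩)
  let N : Subgroup G := (codeSubgroup U C).map SemidirectProduct.inl
  have hN := hL N (by
    simp only [List.mem_map, forall_exists_index, and_imp, forall_apply_eq_imp_iff₂]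
    intro r hr z
    have h₁ := comap_reindex hC r.α_injective r.p₀
    have h₂ := comap_reindex hC r.β_injective r.q₀
    have h₃ := comap_insert (U := U)
      (C := (fun c : P × FreeGroup B => (r.β c.1 * r.q₀, c.2)) ⁻¹' C) r.g
    rw [← h₂, Set.preimage_preimage] at h₃
    have h₄ : (fun c : P × FreeGroup B => (r.β c.1 * r.q₀, c.2 * r.g)) ⁻¹' C =
        (fun c : P × FreeGroup B => (r.α c.1 * r.p₀, c.2)) ⁻¹' C := by
      ext c
      have h : EqvGen (Step rules) (r.α c.1 * r.p₀, c.2) (r.β c.1 * r.q₀, c.2 * r.g) :=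
        .rel _ _ ⟨r, hr, c.1, c.2, rfl, rfl⟩
      exact ⟨fun h' => .trans _ _ _ h' h.symm, fun h' => .trans _ _ _ h' h⟩
    rw [h₄, ← h₁] at h₃
    refine mem_map_inl.trans (Iff.trans (and_congr ?_ ?_) mem_map_inl.symm)
    · exact (SetLike.ext_iff.1 h₃ z.left).symm
    · have e₁ : r.α z.right = 1 ↔ z.right = 1 := map_eq_one_iff _ r.α_injective
      have e₂ : r.β z.right = 1 ↔ z.right = 1 := map_eq_one_iff _ r.β_injective
      exact e₁.trans e₂.symm)
  let j : ShiftFree P B →* K := i.comp SemidirectProduct.inl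
  have hj : Function.Injective j := hi.comp SemidirectProduct.inl_injective
  let M : Subgroup K := Subgroup.closure ({j (code (base, 1))} ∪ T)
  have hcode : ∀ c c', EqvGen (Step rules) c c' → (j (code c) ∈ M ↔ j (code c') ∈ M) := by
    intro c c' h
    induction h with
    | rel c c' h =>
      obtain ⟨r, hr, y, w, rfl, rfl⟩ := h
      obtain ⟨s, hs, h⟩ := hT (Φ r) (List.mem_map_of_mem hr)
      have hs : s ∈ M := Subgroup.subset_closure (.inr hs)
      have := h (SemidirectProduct.inl (code (y, w)))
      have h₁ : (Φ r).1 (SemidirectProduct.inl (code (y, w))) =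
          SemidirectProduct.inl (code (r.α y * r.p₀, w)) := by
        refine (reindexSemi_inl _ _ _).trans (congrArg _ ?_)
        simp [code]
      have h₂ : (Φ r).2 (SemidirectProduct.inl (code (y, w))) =
          SemidirectProduct.inl (code (r.β y * r.q₀, w * r.g)) := by
        refine (congrArg _ (insertSemi_inl _ _)).trans
          ((reindexSemi_inl _ _ _).trans (congrArg _ ?_))
        simp [code, mul_assoc]
      rw [h₁, h₂] at this
      change s * j _ = j _ * s at this
      rw [← Subgroup.mul_mem_cancel_left M hs, this, Subgroup.mul_mem_cancel_right M hs]
    | refl => rfl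
    | symm _ _ _ ih => exact ih.symm
    | trans _ _ _ _ _ ih₁ ih₂ => exact ih₁.trans ih₂
  have hbase : j (code (base, 1)) ∈ M := Subgroup.subset_closure (.inl rfl)
  have hM : M = Subgroup.closure (i '' (N : Set G) ∪ T) := by
    apply le_antisymm
    · refine Subgroup.closure_mono (Set.union_subset_union_left _ ?_)
      rw [Set.singleton_subset_iff]
      exact ⟨_, ⟨_, code_mem_codeSubgroup (C := C) (.refl _), rfl⟩, rfl⟩
    · rw [Subgroup.closure_le, Set.union_subset_iff]
      refine ⟨?_, fun s hs => Subgroup.subset_closure (.inr hs)⟩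
      rintro _ ⟨_, ⟨n, hn, rfl⟩, rfl⟩
      have : codeSubgroup U C ≤ M.comap j := by
        refine codeSubgroup_le (fun w hw => ?_) fun c hc => (hcode _ _ hc).1 hbase
        have h := M.mul_mem ((hcode _ _ hw).1 hbase) (M.inv_mem hbase)
        rw [← map_inv, ← map_mul] at h
        simpa [code] using h
      exact this hn
  refine ⟨K, inferInstance, j.comp (word 1), M, hK, hKt, hj.comp ?_, ?_, ?_⟩
  · exact FreeGroup.map_injective fun a b h => by simpa using h
  · exact ⟨insert (j (code (base, 1))) T, by rw [Finset.coe_insert, Set.insert_eq]⟩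
  · rw [← comap_word hC, hM]
    ext w
    refine (SetLike.ext_iff.1 hN (SemidirectProduct.inl (word 1 w))).trans ?_
    exact mem_map_inl.trans (and_iff_left rfl)

end AffineRule

theorem Group.IsFinitelyPresented.prod_int {G : Type*} [Group G] [IsFinitelyPresented G] :
    IsFinitelyPresented (G × Multiplicative ℤ) := by
  have hG : Group.FG G := fg
  let E := OfHoms (MonoidHom.id G) (MonoidHom.id G) Function.injective_id Function.injective_id
  have hE : IsFinitelyPresented E := OfHoms.isFinitelyPresented
  let f : E →* G × Multiplicative ℤ := OfHoms.desc _ _ (MonoidHom.inl G _)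
    (1, Multiplicative.ofAdd 1) (by simp)
  have ht : ∀ g : G, Commute (t : E) (of g) := fun g => OfHoms.t_mul_of_left g
  let g : G × Multiplicative ℤ →* E := MonoidHom.noncommCoprod of (zpowersHom E t)
    fun x n => by simpa using ((ht x).zpow_left _).symm
  have hf (x : G) : f (of x) = (x, 1) := OfHoms.desc_of _ _ _ x
  have hft : f t = (1, Multiplicative.ofAdd 1) := OfHoms.desc_t _ _ _
  refine equiv (MonoidHom.toMulEquiv f g ?_ ?_)
  · refine HNNExtension.hom_ext ?_ ?_
    · ext x
      simp [hf, g]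
    · rw [MonoidHom.comp_apply, hft]
      simp only [g, MonoidHom.noncommCoprod_apply, map_one, one_mul]
      exact zpow_one (t : E)
  · refine MonoidHom.ext fun x => ?_
    simp [g, hf, hft, ← ofAdd_zsmul]

theorem Group.IsFinitelyPresented.pi_int (ι : Type) [Finite ι] :
    IsFinitelyPresented (Multiplicative (ι → ℤ)) := by
  have key : ∀ n, IsFinitelyPresented (Multiplicative (Fin n → ℤ)) := by
    intro n
    induction n with
    | zero => infer_instance
    | succ n ih =>
      have := prod_int (G := Multiplicative (Fin n → ℤ))
      let e : (Fin n → ℤ) × ℤ ≃+ (Fin (n + 1) → ℤ) :=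
        (AddEquiv.prodComm).trans (Fin.consLinearEquiv ℤ (fun _ => ℤ)).toAddEquiv
      exact equiv ((MulEquiv.prodMultiplicative _ _).symm.trans e.toMultiplicative)
  obtain ⟨n, ⟨e⟩⟩ := Finite.exists_equiv_fin ι
  have := key n
  exact equiv (LinearEquiv.funCongrLeft ℤ ℤ e).toAddEquiv.toMultiplicative

theorem noTorsion_pi_int (ι : Type) : NoTorsion (Multiplicative (ι → ℤ)) := by
  intro x n hn hx
  have h : n • x.toAdd = 0 := hx
  exact (smul_eq_zero.1 h).resolve_left hn.ne'

/-- A rule acting on finitely many stacks by replacing prefixes and changing the state; on the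
stacks marked `exact` the prefix has to be the whole content. -/
structure StackRule (Q ι Γ B : Type) where
  /-- the state before -/
  q : Q
  /-- the state after -/
  next : Q
  /-- the prefixes before -/
  pre : ι → List Γ
  /-- the prefixes after -/
  pre' : ι → List Γ
  /-- the stacks on which the prefix is the whole content -/
  exact : ι → Bool
  /-- the output -/
  out : FreeGroup B

namespace StackRule

open Relation

variable {Q ι Γ B : Type}

/-- One rewriting step, with the output accumulated in the second component. -/
def Step (rules : Set (StackRule Q ι Γ B)) (c c' : (Q × (ι → List Γ)) × FreeGroup B) : Prop :=
  ∃ r ∈ rules, ∃ (l : ι → List Γ) (w : FreeGroup B), (∀ k, r.exact k = true → l k = []) ∧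
    c = ((r.q, fun k => r.pre k ++ l k), w) ∧ c' = ((r.next, fun k => r.pre' k ++ l k), w * r.out)

/-- The encoding of a stack content by an integer in base `N + 2`. -/
def enc {N : ℕ} (e : Γ ≃ Fin N) : List Γ → ℤ
  | [] => 1
  | a :: s => (e a + 2) + (N + 2) * enc e s

/-- The contribution of a prefix to the encoding. -/
def offset {N : ℕ} (e : Γ ≃ Fin N) : List Γ → ℤ
  | [] => 0
  | a :: s => (e a + 2) + (N + 2) * offset e s

section

variable {N : ℕ} (e : Γ ≃ Fin N)

theorem enc_append (p s : List Γ) : enc e (p ++ s) = offset e p + (N + 2) ^ p.length * enc e s := by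
  induction p with
  | nil => simp [offset]
  | cons a p ih =>
    simp only [List.cons_append, enc, offset, ih, List.length_cons]
    ring

theorem digit_eq {N a b : ℕ} (ha : a < N + 2) (hb : b < N + 2) {x y : ℤ}
    (h : a + (N + 2) * x = b + (N + 2) * y) : a = b ∧ x = y := by
  have h₁ : ((a : ℤ) + (N + 2) * x) % (N + 2) = a := by
    rw [Int.add_mul_emod_self_left, Int.emod_eq_of_lt] <;> omega
  have h₂ : ((b : ℤ) + (N + 2) * y) % (N + 2) = b := by
    rw [Int.add_mul_emod_self_left, Int.emod_eq_of_lt] <;> omega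
  have h₃ : (a : ℤ) = b := by rw [← h₁, ← h₂, h]
  refine ⟨by exact_mod_cast h₃, ?_⟩
  rw [h₃] at h
  exact mul_left_cancel₀ (by omega) (add_left_cancel h)

theorem eq_nil_of_enc_eq {s : List Γ} {y : ℤ} (h : enc e s = 1 + (N + 2) * y) :
    s = [] ∧ y = 0 := by
  cases s with
  | nil =>
    have := digit_eq (N := N) (a := 1) (b := 1) (by omega) (by omega) (x := 0) (y := y)
      (by simpa [enc] using h)
    exact ⟨rfl, this.2.symm⟩
  | cons a s =>
    have := digit_eq (N := N) (a := e a + 2) (b := 1) (by omega) (by omega) (by simpa [enc] using h)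
    omega

theorem exists_append_of_enc_eq {p s : List Γ} {y : ℤ}
    (h : enc e s = offset e p + (N + 2) ^ p.length * y) : ∃ l, s = p ++ l ∧ enc e l = y := by
  induction p generalizing s with
  | nil => exact ⟨s, rfl, by simpa [offset] using h⟩
  | cons a p ih =>
    have h' : enc e s = ((e a + 2 : ℕ) : ℤ) + (N + 2) * (offset e p + (N + 2) ^ p.length * y) := by
      rw [h]
      simp only [offset, List.length_cons]
      push_cast
      ring
    cases s with
    | nil =>
      have := digit_eq (N := N) (a := 1) (x := 0) (b := e a + 2) (by omega) (by omega)
        (by rw [← h']; simp [enc])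
      omega
    | cons b s =>
      have := digit_eq (N := N) (a := e b + 2) (b := e a + 2) (x := enc e s) (by omega) (by omega)
        (by rw [← h']; simp [enc])
      obtain ⟨l, rfl, hl⟩ := ih this.2
      have hab : b = a := e.injective (Fin.ext (by omega))
      exact ⟨l, by simp [hab], hl⟩

theorem enc_injective : Function.Injective (enc e) := by
  intro s s' h
  have : enc e s = offset e s' + (N + 2) ^ s'.length * 1 := by
    rw [h, ← List.append_nil s', enc_append]
    simp [enc]
  obtain ⟨l, rfl, hl⟩ := exists_append_of_enc_eq e this
  have := (eq_nil_of_enc_eq e (s := l) (y := 0) (by simpa using hl)).1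
  simp [this]

variable {M : ℕ} (u : Q ≃ Fin M)

/-- The encoding of a configuration; the coordinate `none` holds the state. -/
def encConfig (c : Q × (ι → List Γ)) : Multiplicative (Option ι → ℤ) :=
  Multiplicative.ofAdd fun
    | none => u c.1
    | some k => enc e (c.2 k)

theorem encConfig_injective : Function.Injective (encConfig (ι := ι) e u) := by
  rintro ⟨q, x⟩ ⟨q', x'⟩ h
  have hxy (k : Option ι) := congrFun (congrArg Multiplicative.toAdd h) k
  ext1
  · exact u.injective (Fin.ext (by simpa [encConfig] using hxy none))
  · funext k
    exact enc_injective e (by simpa [encConfig] using hxy (some k))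

/-- Coordinatewise multiplication by nonzero factors. -/
def scale (m : Option ι → ℤ) : Multiplicative (Option ι → ℤ) →* Multiplicative (Option ι → ℤ) :=
  AddMonoidHom.toMultiplicative (AddMonoidHom.mulLeft m)

theorem scale_injective {m : Option ι → ℤ} (hm : ∀ k, m k ≠ 0) :
    Function.Injective (scale m) := by
  intro x y h
  have hxy : m * x.toAdd = m * y.toAdd := h
  refine Multiplicative.toAdd.injective (funext fun k => ?_)
  exact mul_left_cancel₀ (hm k) (congrFun hxy k)

/-- The scaling factor belonging to a family of prefixes. -/
def factor (N M : ℕ) (pre : ι → List Γ) (exact : ι → Bool) : Option ι → ℤ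
  | none => M + 2
  | some k => (N + 2) ^ (pre k).length * (if exact k then (N + 2 : ℤ) else 1)

/-- The translation belonging to a state and a family of prefixes. -/
def translation (q : Q) (pre : ι → List Γ) (exact : ι → Bool) :
    Multiplicative (Option ι → ℤ) := Multiplicative.ofAdd fun
  | none => u q
  | some k => offset e (pre k) + (N + 2) ^ (pre k).length * (if exact k then (1 : ℤ) else 0)

/-- The parameter encoding a family of remainders. -/
def param {N : ℕ} (e : Γ ≃ Fin N) (exact : ι → Bool) (l : ι → List Γ) :
    Multiplicative (Option ι → ℤ) := Multiplicative.ofAdd fun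
  | none => 0
  | some k => if exact k then 0 else enc e (l k)

theorem factor_ne_zero (pre : ι → List Γ) (exact : ι → Bool) (k) : factor N M pre exact k ≠ 0 := by
  have : (N : ℤ) + 2 ≠ 0 := by omega
  have : (M : ℤ) + 2 ≠ 0 := by omega
  rcases k with _ | k
  · assumption
  · simp only [factor]
    split_ifs <;> simp_all

theorem encConfig_eq (q : Q) (pre : ι → List Γ) {exact : ι → Bool} {l : ι → List Γ}
    (hl : ∀ k, exact k = true → l k = []) : encConfig e u (q, fun k => pre k ++ l k) =
      scale (factor N M pre exact) (param e exact l) * translation e u q pre exact := by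
  refine Multiplicative.toAdd.injective (funext fun k => ?_)
  change _ = factor N M pre exact k * (param e exact l).toAdd k +
    (translation e u q pre exact).toAdd k
  rcases k with _ | k
  · simp [encConfig, param, translation]
  · by_cases hk : exact k = true
    · simp [encConfig, factor, param, translation, enc_append, hk, hl k hk, enc]
    · simp [encConfig, factor, param, translation, enc_append, hk]
      ring

theorem exists_of_encConfig_eq {c : Q × (ι → List Γ)} {q : Q} {pre : ι → List Γ}
    {exact : ι → Bool} {y : Multiplicative (Option ι → ℤ)}
    (h : encConfig e u c = scale (factor N M pre exact) y * translation e u q pre exact) :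
    ∃ l : ι → List Γ, (∀ k, exact k = true → l k = []) ∧ c = (q, fun k => pre k ++ l k) ∧
      y = param e exact l := by
  have h' (k) : (encConfig e u c).toAdd k = factor N M pre exact k * y.toAdd k +
    (translation e u q pre exact).toAdd k := congrFun (congrArg Multiplicative.toAdd h) k
  have hs (k : ι) : ∃ l, c.2 k = pre k ++ l ∧ (exact k = true → l = []) ∧
      y.toAdd (some k) = if exact k then 0 else enc e l := by
    have := h' (some k)
    by_cases hk : exact k = true
    · simp only [encConfig, factor, translation, hk, if_true, toAdd_ofAdd] at this
      obtain ⟨l, h₁, h₂⟩ := exists_append_of_enc_eq e (s := c.2 k) (p := pre k)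
        (y := 1 + (N + 2) * y.toAdd (some k)) (by rw [this]; ring)
      obtain ⟨rfl, h₃⟩ := eq_nil_of_enc_eq e h₂
      exact ⟨[], h₁, fun _ => rfl, by simp [hk, h₃]⟩
    · simp only [encConfig, factor, translation, hk, toAdd_ofAdd] at this
      obtain ⟨l, h₁, h₂⟩ := exists_append_of_enc_eq e (s := c.2 k) (p := pre k)
        (y := y.toAdd (some k)) (by rw [this]; simp; ring)
      exact ⟨l, h₁, fun h => absurd h hk, by simp [hk, h₂]⟩
  choose l hl₁ hl₂ hl₃ using hs
  have hq := h' none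
  simp only [encConfig, factor, translation, toAdd_ofAdd] at hq
  have hq' := digit_eq (N := M) (a := u c.1) (b := u q) (x := 0) (y := y.toAdd none) (by omega)
    (by omega) (by rw [mul_zero, add_zero, hq]; ring)
  refine ⟨l, hl₂, Prod.ext (u.injective (Fin.ext hq'.1)) (funext hl₁), ?_⟩
  refine Multiplicative.toAdd.injective (funext fun k => ?_)
  rcases k with _ | k
  · exact hq'.2.symm
  · exact hl₃ k

/-- The affine rule simulating a stack rule. -/
def toAffineRule (r : StackRule Q ι Γ B) : AffineRule (Multiplicative (Option ι → ℤ)) B where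
  α := scale (factor N M r.pre r.exact)
  β := scale (factor N M r.pre' r.exact)
  p₀ := translation e u r.q r.pre r.exact
  q₀ := translation e u r.next r.pre' r.exact
  g := r.out
  α_injective := scale_injective (factor_ne_zero _ _)
  β_injective := scale_injective (factor_ne_zero _ _)

end

theorem exists_fg_mem_iff_eqvGen [Finite Q] [Finite ι] [Finite Γ] [Finite B]
    {rules : Set (StackRule Q ι Γ B)} (hrules : rules.Finite) (base : Q × (ι → List Γ)) :
    ∃ (K : Type) (_ : Group K) (i : FreeGroup B →* K) (L : Subgroup K),
      Group.IsFinitelyPresented K ∧ NoTorsion K ∧ Function.Injective i ∧ L.FG ∧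
        ∀ w, i w ∈ L ↔ EqvGen (Step rules) (base, 1) (base, w) := by
  obtain ⟨N, ⟨e⟩⟩ := Finite.exists_equiv_fin Γ
  obtain ⟨M, ⟨u⟩⟩ := Finite.exists_equiv_fin Q
  have := Group.IsFinitelyPresented.pi_int (Option ι)
  let l := hrules.toFinset.toList.map (toAffineRule e u)
  have hl (a) : a ∈ l ↔ ∃ r ∈ rules, toAffineRule e u r = a := by simp [l]
  obtain ⟨K, _, i, L, hK, hKt, hi, hL, h⟩ := AffineRule.exists_fg_comap_eq_loops
    (noTorsion_pi_int (Option ι)) l (encConfig e u base)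
  refine ⟨K, inferInstance, i, L, hK, hKt, hi, hL, fun w => ?_⟩
  let E (c : (Q × (ι → List Γ)) × FreeGroup B) := (encConfig e u c.1, c.2)
  have hE : Function.Injective E := (encConfig_injective e u).prodMap Function.injective_id
  have h₁ (c c') (h : Step rules c c') : AffineRule.Step l (E c) (E c') := by
    obtain ⟨r, hr, x, w, hx, rfl, rfl⟩ := h
    exact ⟨_, (hl _).2 ⟨r, hr, rfl⟩, param e r.exact x, w, Prod.ext (encConfig_eq e u _ _ hx) rfl,
      Prod.ext (encConfig_eq e u _ _ hx) rfl⟩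
  have h₂ (x y) (h : EqvGen (AffineRule.Step l) x y) :
      (∀ c, E c = x → ∃ c', E c' = y ∧ EqvGen (Step rules) c c') ∧
      (∀ c, E c = y → ∃ c', E c' = x ∧ EqvGen (Step rules) c c') := by
    induction h with
    | rel x y h =>
      obtain ⟨_, ha, z, w, rfl, rfl⟩ := h
      obtain ⟨r, hr, rfl⟩ := (hl _).1 ha
      constructor <;> rintro ⟨c, v⟩ h
      · obtain ⟨s, hs, rfl, rfl⟩ := exists_of_encConfig_eq e u (congrArg Prod.fst h)
        obtain rfl : v = w := congrArg Prod.snd h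
        exact ⟨((r.next, fun k => r.pre' k ++ s k), v * r.out),
          Prod.ext (encConfig_eq e u _ _ hs) rfl, .rel _ _ ⟨r, hr, s, v, hs, rfl, rfl⟩⟩
      · obtain ⟨s, hs, rfl, rfl⟩ := exists_of_encConfig_eq e u (congrArg Prod.fst h)
        obtain rfl : v = w * r.out := congrArg Prod.snd h
        exact ⟨((r.q, fun k => r.pre k ++ s k), w),
          Prod.ext (encConfig_eq e u _ _ hs) rfl, .symm _ _ (.rel _ _ ⟨r, hr, s, w, hs, rfl, rfl⟩)⟩
    | refl x => exact ⟨fun c hc => ⟨c, hc, .refl _⟩, fun c hc => ⟨c, hc, .refl _⟩⟩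
    | symm _ _ _ ih => exact ih.symm
    | trans _ _ _ _ _ ih₁ ih₂ =>
      constructor <;> intro c hc
      · obtain ⟨c₁, hc₁, h₁⟩ := ih₁.1 c hc
        obtain ⟨c₂, hc₂, h₂⟩ := ih₂.1 c₁ hc₁
        exact ⟨c₂, hc₂, h₁.trans _ _ _ h₂⟩
      · obtain ⟨c₁, hc₁, h₁⟩ := ih₂.2 c hc
        obtain ⟨c₂, hc₂, h₂⟩ := ih₁.2 c₁ hc₁
        exact ⟨c₂, hc₂, h₁.trans _ _ _ h₂⟩
  rw [← Subgroup.mem_comap, h]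
  constructor
  · intro h
    obtain ⟨c', hc', hc⟩ := (h₂ _ _ h).1 (base, 1) rfl
    obtain rfl : c' = (base, w) := hE hc'
    exact hc
  · intro h
    have : ∀ c c', EqvGen (Step rules) c c' → EqvGen (AffineRule.Step l) (E c) (E c') := by
      intro c c' h
      induction h with
      | rel _ _ h => exact .rel _ _ (h₁ _ _ h)
      | refl => exact .refl _
      | symm _ _ _ ih => exact ih.symm
      | trans _ _ _ _ _ ih₁ ih₂ => exact ih₁.trans _ _ _ ih₂
    exact this _ _ h

end StackRule

open Relation

/-- A deterministic machine with finitely many stacks; in each step it inspects and rewrites the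
top of one stack. -/
structure StackMachine (Q K Γ : Type) where
  /-- the stack acted on -/
  act : Q → K
  /-- the transition function -/
  δ : Q → Option Γ → Option (Q × List Γ)

/-- The states of the rewriting system enumerating the outputs of a machine. -/
inductive EnumState (Q : Type)
  | grow
  | transfer
  | run (q : Q)
  | output

instance (Q : Type) [Finite Q] : Finite (EnumState Q) := by
  refine Finite.of_surjective (α := Option (Option (Option Q))) (fun
    | none => .grow
    | some none => .transfer
    | some (some none) => .output
    | some (some (some q)) => .run q) ?_
  rintro (_ | _ | q | _)
  exacts [⟨none, rfl⟩, ⟨some none, rfl⟩, ⟨some (some (some q)), rfl⟩, ⟨some (some none), rfl⟩]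

namespace StackMachine

variable {Q K Γ B : Type} [DecidableEq K]

/-- One step of a stack machine. -/
def step (m : StackMachine Q K Γ) (c : Q × (K → List Γ)) : Option (Q × (K → List Γ)) :=
  (m.δ c.1 (c.2 (m.act c.1)).head?).map fun p =>
    (p.1, Function.update c.2 (m.act c.1) (p.2 ++ (c.2 (m.act c.1)).tail))

/-- Stacks that are empty with one exception. -/
def single (k : K) (s : List Γ) : K → List Γ := Function.update (fun _ => []) k s

@[simp] theorem single_self (k : K) (s : List Γ) : single k s k = s := by simp [single]

theorem single_of_ne {k k' : K} (h : k' ≠ k) (s : List Γ) : single k s k' = [] := by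
  simp [single, h]

theorem single_append (k : K) (s : List Γ) (S : K → List Γ) :
    (fun k' => single k s k' ++ S k') = Function.update S k (s ++ S k) := by
  funext k'
  by_cases h : k' = k
  · subst h; simp
  · simp [single_of_ne h, h]

/-- The prefix code for words. -/
def codeWord (b₀ b₁ e : Γ) (code : B × Bool → ℕ) : List (B × Bool) → List Γ
  | [] => [e]
  | x :: l => List.replicate (code x) b₀ ++ b₁ :: codeWord b₀ b₁ e code l

section

variable {b₀ b₁ e : Γ} {code : B × Bool → ℕ}

theorem replicate_append_cons_inj {b₀ b₁ : Γ} (h : b₀ ≠ b₁) {m n : ℕ} {s t : List Γ}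
    (h' : List.replicate m b₀ ++ b₁ :: s = List.replicate n b₀ ++ b₁ :: t) : m = n ∧ s = t := by
  induction m generalizing n with
  | zero =>
    cases n with
    | zero => simpa using h'
    | succ n => simp [List.replicate_succ, h.symm] at h'
  | succ m ih =>
    cases n with
    | zero => simp [List.replicate_succ, h] at h'
    | succ n =>
      have := ih (n := n) (by simpa [List.replicate_succ] using h')
      simpa using this

theorem codeWord_eq_append (h₀ : b₀ ≠ b₁) (h₁ : b₀ ≠ e) (h₂ : b₁ ≠ e)
    (hcode : Function.Injective code) {l : List (B × Bool)} {x : B × Bool} {s : List Γ}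
    (h : codeWord b₀ b₁ e code l = List.replicate (code x) b₀ ++ b₁ :: s) :
    ∃ l', l = x :: l' ∧ s = codeWord b₀ b₁ e code l' := by
  cases l with
  | nil => cases hx : code x <;> simp [codeWord, hx, List.replicate_succ, h₁.symm, h₂.symm] at h
  | cons y l =>
    obtain ⟨hxy, rfl⟩ := replicate_append_cons_inj h₀ h
    exact ⟨l, by rw [hcode hxy], rfl⟩

theorem codeWord_eq_singleton (h₁ : b₀ ≠ e) (h₂ : b₁ ≠ e) {l : List (B × Bool)}
    (h : codeWord b₀ b₁ e code l = [e]) : l = [] := by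
  cases l with
  | nil => rfl
  | cons x l => cases hx : code x <;> simp [codeWord, hx, List.replicate_succ, h₁, h₂] at h

theorem codeWord_injective (h₀ : b₀ ≠ b₁) (h₁ : b₀ ≠ e) (h₂ : b₁ ≠ e)
    (hcode : Function.Injective code) : Function.Injective (codeWord b₀ b₁ e code) := by
  intro l
  induction l with
  | nil => exact fun l h => (codeWord_eq_singleton h₁ h₂ h.symm).symm
  | cons x l ih =>
    intro l' h
    obtain ⟨l'', rfl, hl⟩ := codeWord_eq_append h₀ h₁ h₂ hcode h.symm
    rw [ih hl]

end

/-- A family of stacks extended by a counter. -/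
def withCounter (s : List Γ) (S : K → List Γ) : Option K → List Γ
  | none => s
  | some k => S k

section Rules

variable (m : StackMachine Q K Γ) (main : K) (b₀ b₁ e : Γ) (code : B × Bool → ℕ) (q₀ q₁ : Q)

/-- Increase the counter. -/
def growRule : StackRule (EnumState Q) (Option K) Γ B :=
  ⟨.grow, .grow, withCounter [] fun _ => [], withCounter [b₀] fun _ => [], fun _ => false, 1⟩

/-- Begin to move the counter to the main stack. -/
def startRule : StackRule (EnumState Q) (Option K) Γ B :=
  ⟨.grow, .transfer, withCounter [] (single main [b₁, e]), withCounter [] (single main [b₁, e]),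
    Option.isSome, 1⟩

/-- Move one unit from the counter to the main stack. -/
def moveRule : StackRule (EnumState Q) (Option K) Γ B :=
  ⟨.transfer, .transfer, withCounter [b₀] fun _ => [], withCounter [] (single main [b₀]),
    fun _ => false, 1⟩

/-- Start the machine once the counter is empty. -/
def launchRule : StackRule (EnumState Q) (Option K) Γ B :=
  ⟨.transfer, .run q₀, withCounter [] fun _ => [], withCounter [] fun _ => [], Option.isNone, 1⟩

/-- Execute one step of the machine. -/
def runRule (q : Q) (h : Option Γ) (q' : Q) (s : List Γ) :
    StackRule (EnumState Q) (Option K) Γ B :=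
  ⟨.run q, .run q', withCounter [] (single (m.act q) h.toList), withCounter [] (single (m.act q) s),
    fun k => h.isNone && k == some (m.act q), 1⟩

/-- Pass from the final state of the machine to the output phase. -/
def haltRule : StackRule (EnumState Q) (Option K) Γ B :=
  ⟨.run q₁, .output, withCounter [] fun _ => [], withCounter [] fun _ => [], fun _ => false, 1⟩

/-- Output one letter. -/
def emitRule (x : B × Bool) : StackRule (EnumState Q) (Option K) Γ B :=
  ⟨.output, .output, withCounter [] (single main (List.replicate (code x) b₀ ++ [b₁])),
    withCounter [] fun _ => [], fun _ => false, FreeGroup.mk [x]⟩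

/-- Return to the initial configuration. -/
def finishRule : StackRule (EnumState Q) (Option K) Γ B :=
  ⟨.output, .grow, withCounter [] (single main [e]), withCounter [] (single main [b₁, e]),
    fun _ => true, 1⟩

/-- The rewriting system enumerating the outputs of a machine. -/
def rules : Set (StackRule (EnumState Q) (Option K) Γ B) :=
  {growRule b₀, startRule main b₁ e, moveRule main b₀, launchRule q₀, haltRule q₁,
    finishRule main b₁ e} ∪ Set.range (emitRule main b₀ b₁ code) ∪
    {r | ∃ q h q' s, m.δ q h = some (q', s) ∧ r = runRule m q h q' s}

theorem finite_rules [Finite Q] [Finite Γ] [Finite B] :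
    (rules m main b₀ b₁ e code q₀ q₁).Finite := by
  refine ((Set.toFinite _).union (Set.finite_range _)).union ?_
  refine (Set.finite_range fun p : Q × Option Γ => (m.δ p.1 p.2).elim (growRule (Q := Q) b₀)
    fun x => runRule m p.1 p.2 x.1 x.2).subset ?_
  rintro _ ⟨q, h, q', s, hδ, rfl⟩
  exact ⟨(q, h), by simp [hδ]⟩

variable (N : Subgroup (FreeGroup B))

/-- The invariant of the rewriting system. -/
def Inv : (EnumState Q × (Option K → List Γ)) × FreeGroup B → Prop
  | ((.grow, S), w) => ∃ n, S none = List.replicate n b₀ ∧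
      (fun k => S (some k)) = single main [b₁, e] ∧ w ∈ N
  | ((.transfer, S), w) => ∃ n l, S none = List.replicate n b₀ ∧
      StateTransition.Reaches m.step (q₀, Function.update (fun k => S (some k)) main
        (List.replicate n b₀ ++ S (some main))) (q₁, single main (codeWord b₀ b₁ e code l)) ∧
      w * FreeGroup.mk l ∈ N
  | ((.run q, S), w) => S none = [] ∧ ∃ l, StateTransition.Reaches m.step (q, fun k => S (some k))
      (q₁, single main (codeWord b₀ b₁ e code l)) ∧ w * FreeGroup.mk l ∈ N
  | ((.output, S), w) => S none = [] ∧ ∃ l, (fun k => S (some k)) =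
      single main (codeWord b₀ b₁ e code l) ∧ w * FreeGroup.mk l ∈ N

end Rules

variable {m : StackMachine Q K Γ} {main : K} {b₀ b₁ e : Γ} {code : B × Bool → ℕ} {q₀ q₁ : Q}
  {f : ℕ → FreeGroup B}

theorem reaches_iff_of_step {c c' d : Q × (K → List Γ)} (h : m.step c = some c')
    (hd : m.step d = none) : StateTransition.Reaches m.step c d ↔
      StateTransition.Reaches m.step c' d := by
  constructor
  · intro h'
    rcases Relation.ReflTransGen.cases_head h' with rfl | ⟨c'', h₁, h₂⟩
    · simp [h] at hd
    · rw [Option.mem_def, h, Option.some_inj] at h₁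
      exact h₁ ▸ h₂
  · exact fun h' => .head h h'

theorem inv_iff_of_step [DecidableEq B] (h₀ : b₀ ≠ b₁) (h₁ : b₀ ≠ e) (h₂ : b₁ ≠ e)
    (hcode : Function.Injective code) (hq₁ : ∀ h, m.δ q₁ h = none) {N : Subgroup (FreeGroup B)}
    (hN : ∀ n, f n ∈ N)
    (hf : ∀ n, StateTransition.Reaches m.step (q₀, single main (List.replicate n b₀ ++ [b₁, e]))
      (q₁, single main (codeWord b₀ b₁ e code (f n).toWord)))
    {c c' : (EnumState Q × (Option K → List Γ)) × FreeGroup B}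
    (h : StackRule.Step (rules m main b₀ b₁ e code q₀ q₁) c c') :
    Inv m main b₀ b₁ e code q₀ q₁ N c ↔ Inv m main b₀ b₁ e code q₀ q₁ N c' := by
  have hstep (S : K → List Γ) : m.step (q₁, S) = none := by simp [step, hq₁]
  obtain ⟨r, hr, S, w, hS, rfl, rfl⟩ := h
  obtain (((rfl | rfl | rfl | rfl | rfl | rfl) | ⟨x, rfl⟩) | ⟨q, h, q', s, hδ, rfl⟩) := hr
  · simp only [growRule, withCounter, Inv, List.nil_append, mul_one, List.singleton_append]
    constructor
    · rintro ⟨n, h, h'⟩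
      exact ⟨n + 1, by rw [h]; rfl, h'⟩
    · rintro ⟨_ | n, h, h'⟩
      · simp at h
      · exact ⟨n, by simpa [List.replicate_succ] using h, h'⟩
  · have hS' (k) : S (some k) = [] := hS (some k) rfl
    simp only [startRule, withCounter, Inv, List.nil_append, mul_one, hS', List.append_nil]
    have hu (n) : Function.update (single main [b₁, e]) main
        (List.replicate n b₀ ++ single main [b₁, e] main) =
        single main (List.replicate n b₀ ++ [b₁, e]) := by simp [single]
    simp only [hu, true_and]
    constructor
    · rintro ⟨n, h, hw⟩
      exact ⟨n, _, h, hf n, N.mul_mem hw (by simpa only [FreeGroup.mk_toWord] using hN n)⟩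
    · rintro ⟨n, l, h, h', hw⟩
      refine ⟨n, h, ?_⟩
      have := Part.mem_unique (StateTransition.mem_eval.2 ⟨h', hstep _⟩)
        (StateTransition.mem_eval.2 ⟨hf n, hstep _⟩)
      have := congrFun (congrArg Prod.snd this) main
      simp only [single_self] at this
      rw [codeWord_injective h₀ h₁ h₂ hcode this, FreeGroup.mk_toWord] at hw
      exact (N.mul_mem_cancel_right (hN n)).1 hw
  · simp only [moveRule, withCounter, Inv, List.nil_append, mul_one, List.singleton_append,
      single_append]
    constructor
    · rintro ⟨_ | n, l, h, h'⟩
      · simp at h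
      · refine ⟨n, l, by simpa [List.replicate_succ] using h, ?_⟩
        simpa [List.replicate_succ'] using h'
    · rintro ⟨n, l, h, h'⟩
      refine ⟨n + 1, l, by rw [h]; rfl, ?_⟩
      simpa [List.replicate_succ'] using h'
  · have hS' : S none = [] := hS none rfl
    simp only [launchRule, withCounter, Inv, List.nil_append, mul_one, hS', true_and]
    constructor
    · rintro ⟨_ | n, l, h, h'⟩
      · exact ⟨l, by simpa using h'⟩
      · simp [List.replicate_succ] at h
    · rintro ⟨l, h⟩
      exact ⟨0, l, rfl, by simpa using h⟩
  · simp only [haltRule, withCounter, Inv, List.nil_append, mul_one]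
    refine and_congr_right fun _ => exists_congr fun l => and_congr_left fun _ => ?_
    constructor
    · intro h
      have := Part.mem_unique (StateTransition.mem_eval.2 ⟨h, hstep _⟩)
        (StateTransition.mem_eval.2 ⟨.refl, hstep _⟩)
      exact (congrArg Prod.snd this).symm
    · intro h
      rw [h]
      exact .refl
  · have hS' (k) : S k = [] := hS k rfl
    simp only [finishRule, withCounter, Inv, mul_one, hS', List.append_nil, true_and]
    constructor
    · rintro ⟨l, h, hw⟩
      have := congrFun h main
      simp only [single_self] at this
      rw [codeWord_eq_singleton h₁ h₂ this.symm] at hw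
      exact ⟨0, rfl, by simpa [← FreeGroup.one_eq_mk] using hw⟩
    · rintro ⟨n, h, hw⟩
      exact ⟨[], rfl, by simpa [← FreeGroup.one_eq_mk] using hw⟩
  · simp only [emitRule, withCounter, Inv, List.nil_append, single_append]
    refine and_congr_right fun _ => ?_
    constructor
    · rintro ⟨l, h, hw⟩
      have := congrFun h main
      simp only [single_self, Function.update_self, List.append_assoc, List.singleton_append]
        at this
      obtain ⟨l', rfl, hl⟩ := codeWord_eq_append h₀ h₁ h₂ hcode this.symm
      refine ⟨l', ?_, by simpa [mul_assoc] using hw⟩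
      funext k
      by_cases hk : k = main
      · subst hk; simp [hl]
      · have := congrFun h k
        simpa [hk, single_of_ne hk] using this
    · rintro ⟨l, h, hw⟩
      refine ⟨x :: l, ?_, by simpa [mul_assoc] using hw⟩
      rw [h]
      have := congrFun h main
      simp only [single_self] at this
      simp [single, codeWord, this]
  · simp only [runRule, withCounter, Inv, List.nil_append, mul_one, single_append]
    refine and_congr_right fun _ => exists_congr fun l => and_congr_left fun _ => ?_
    refine reaches_iff_of_step ?_ (hstep _)
    cases h with
    | none =>
      have h' : S (some (m.act q)) = [] := hS _ (by simp [runRule])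
      simp [step, h', hδ]
    | some a => simp [step, hδ]

variable (m main b₀ b₁ e code q₀ q₁) in
/-- The equivalence relation generated by the rules. -/
abbrev Equivalent (c c' : (EnumState Q × (Option K → List Γ)) × FreeGroup B) : Prop :=
  EqvGen (StackRule.Step (rules m main b₀ b₁ e code q₀ q₁)) c c'

theorem equivalent_grow (n : ℕ) (S : K → List Γ) (w : FreeGroup B) :
    Equivalent m main b₀ b₁ e code q₀ q₁ ((.grow, withCounter [] S), w)
      ((.grow, withCounter (List.replicate n b₀) S), w) := by
  induction n with
  | zero => exact .refl _
  | succ n ih =>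
    refine ih.trans _ _ _ (.rel _ _ ⟨growRule b₀, by simp [rules],
      withCounter (List.replicate n b₀) S, w, by simp [growRule], ?_, ?_⟩)
    · congr 2; funext k; cases k <;> simp [growRule, withCounter]
    · simp only [growRule, mul_one]
      congr 2; funext k; cases k <;> simp [withCounter, List.replicate_succ]

theorem equivalent_transfer (n : ℕ) (s : List Γ) (w : FreeGroup B) :
    Equivalent m main b₀ b₁ e code q₀ q₁
      ((.transfer, withCounter (List.replicate n b₀) (single main s)), w)
      ((.transfer, withCounter [] (single main (List.replicate n b₀ ++ s))), w) := by
  induction n generalizing s with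
  | zero => exact .refl _
  | succ n ih =>
    rw [List.replicate_succ', List.append_assoc, ← List.replicate_succ', List.replicate_succ]
    refine .trans _ _ _ (.rel _ _ ⟨moveRule main b₀, by simp [rules],
      withCounter (List.replicate n b₀) (single main s), w, by simp [moveRule], ?_, rfl⟩) ?_
    · congr 2; funext k; cases k <;> simp [moveRule, withCounter]
    · convert ih (b₀ :: s) using 3
      · rfl
      · funext k
        cases k with
        | none => simp [moveRule, withCounter]
        | some k =>
          by_cases hk : k = main
          · subst hk; simp [moveRule, withCounter]
          · simp [moveRule, withCounter, single_of_ne hk]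
      · simp [moveRule]
      · simp

theorem equivalent_run {c c' : Q × (K → List Γ)} (h : StateTransition.Reaches m.step c c')
    (w : FreeGroup B) : Equivalent m main b₀ b₁ e code q₀ q₁
      ((.run c.1, withCounter [] c.2), w) ((.run c'.1, withCounter [] c'.2), w) := by
  induction h with
  | refl => exact .refl _
  | @tail c c' _ h ih =>
    refine ih.trans _ _ _ ?_
    obtain ⟨q, S⟩ := c
    simp only [step, Option.mem_def, Option.map_eq_some_iff] at h
    obtain ⟨⟨q', s⟩, hδ, rfl⟩ := h
    refine .rel _ _ ⟨runRule m q (S (m.act q)).head? q' s, .inr ⟨_, _, _, _, hδ, rfl⟩,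
      withCounter [] (Function.update S (m.act q) (S (m.act q)).tail), w, ?_, ?_, ?_⟩
    · rintro (_ | k) hk
      · rfl
      · simp only [runRule, Bool.and_eq_true, Option.isNone_iff_eq_none, List.head?_eq_none_iff,
          beq_iff_eq, Option.some_inj] at hk
        obtain ⟨hk, rfl⟩ := hk
        simp [withCounter, hk]
    · simp only [runRule]
      congr 2
      funext k
      cases k with
      | none => simp [withCounter]
      | some k =>
        by_cases hk : k = m.act q
        · subst hk
          cases hS : S (m.act q) <;> simp [withCounter, hS]
        · simp [withCounter, single_of_ne hk, hk]
    · simp only [runRule, mul_one]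
      congr 2
      funext k
      cases k with
      | none => simp [withCounter]
      | some k =>
        by_cases hk : k = m.act q
        · subst hk; simp [withCounter]
        · simp [withCounter, single_of_ne hk, hk]

theorem equivalent_output (l : List (B × Bool)) (w : FreeGroup B) :
    Equivalent m main b₀ b₁ e code q₀ q₁
      ((.output, withCounter [] (single main (codeWord b₀ b₁ e code l))), w)
      ((.grow, withCounter [] (single main [b₁, e])), w * FreeGroup.mk l) := by
  induction l generalizing w with
  | nil =>
    rw [← FreeGroup.one_eq_mk, mul_one]
    refine .rel _ _ ⟨finishRule main b₁ e, by simp [rules], fun _ => [], w, fun _ _ => rfl, ?_, ?_⟩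
    · simp [finishRule, codeWord]
    · simp [finishRule]
  | cons x l ih =>
    have := ih (w * FreeGroup.mk [x])
    rw [mul_assoc, FreeGroup.mul_mk, List.singleton_append] at this
    refine .trans _ _ _ (.rel _ _ ⟨emitRule main b₀ b₁ code x, .inl (.inr ⟨x, rfl⟩),
      withCounter [] (single main (codeWord b₀ b₁ e code l)), w, by simp [emitRule], ?_, ?_⟩) this
    · simp only [emitRule]
      congr 2
      funext k
      cases k with
      | none => simp [withCounter]
      | some k =>
        by_cases hk : k = main
        · subst hk; simp [withCounter, codeWord]
        · simp [withCounter, single_of_ne hk]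
    · simp only [emitRule]
      congr 2
      funext k
      cases k <;> simp [withCounter]

theorem equivalent_of_reaches {n : ℕ} {l : List (B × Bool)}
    (h : StateTransition.Reaches m.step (q₀, single main (List.replicate n b₀ ++ [b₁, e]))
      (q₁, single main (codeWord b₀ b₁ e code l))) :
    Equivalent m main b₀ b₁ e code q₀ q₁
      ((.grow, withCounter [] (single main [b₁, e])), 1)
      ((.grow, withCounter [] (single main [b₁, e])), FreeGroup.mk l) := by
  have h₁ : Equivalent m main b₀ b₁ e code q₀ q₁
      ((.grow, withCounter (List.replicate n b₀) (single main [b₁, e])), 1)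
      ((.transfer, withCounter (List.replicate n b₀) (single main [b₁, e])), 1) := by
    refine .rel _ _ ⟨startRule main b₁ e, by simp [rules],
      withCounter (List.replicate n b₀) fun _ => [], 1, ?_, ?_, ?_⟩
    · rintro (_ | k) hk
      · simp [startRule] at hk
      · rfl
    · simp only [startRule]
      congr 2; funext k; cases k <;> simp [withCounter]
    · simp only [startRule]
      rw [mul_one]
      congr 2; funext k; cases k <;> simp [withCounter]
  have h₂ : Equivalent m main b₀ b₁ e code q₀ q₁
      ((.transfer, withCounter [] (single main (List.replicate n b₀ ++ [b₁, e]))), 1)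
      ((.run q₀, withCounter [] (single main (List.replicate n b₀ ++ [b₁, e]))), 1) := by
    refine .rel _ _ ⟨launchRule q₀, by simp [rules],
      withCounter [] (single main (List.replicate n b₀ ++ [b₁, e])), 1, ?_, ?_, ?_⟩
    · rintro (_ | k) hk
      · rfl
      · simp [launchRule] at hk
    · simp only [launchRule]
      congr 2; funext k; cases k <;> simp [withCounter]
    · simp only [launchRule]
      rw [mul_one]
      congr 2; funext k; cases k <;> simp [withCounter]
  have h₃ : Equivalent m main b₀ b₁ e code q₀ q₁
      ((.run q₁, withCounter [] (single main (codeWord b₀ b₁ e code l))), 1)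
      ((.output, withCounter [] (single main (codeWord b₀ b₁ e code l))), 1) := by
    refine .rel _ _ ⟨haltRule q₁, by simp [rules],
      withCounter [] (single main (codeWord b₀ b₁ e code l)), 1, by simp [haltRule], ?_, ?_⟩
    · simp only [haltRule]
      congr 2; funext k; cases k <;> simp [withCounter]
    · simp only [haltRule]
      rw [mul_one]
      congr 2; funext k; cases k <;> simp [withCounter]
  refine (equivalent_grow n _ _).trans _ _ _ (h₁.trans _ _ _
    ((equivalent_transfer n _ _).trans _ _ _ (h₂.trans _ _ _
    ((equivalent_run h 1).trans _ _ _ (h₃.trans _ _ _ ?_)))))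
  simpa only [one_mul] using equivalent_output (m := m) (q₀ := q₀) (q₁ := q₁) l 1

theorem exists_fg_comap_eq [DecidableEq B] [Finite Q] [Finite K] [Finite Γ] [Finite B]
    (h₀ : b₀ ≠ b₁) (h₁ : b₀ ≠ e) (h₂ : b₁ ≠ e)
    (hcode : Function.Injective code) (hq₁ : ∀ h, m.δ q₁ h = none)
    (hf : ∀ n, StateTransition.Reaches m.step (q₀, single main (List.replicate n b₀ ++ [b₁, e]))
      (q₁, single main (codeWord b₀ b₁ e code (f n).toWord))) :
    ∃ (G : Type) (_ : Group G) (i : FreeGroup B →* G) (L : Subgroup G),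
      Group.IsFinitelyPresented G ∧ NoTorsion G ∧ Function.Injective i ∧ L.FG ∧
      (∀ n, i (f n) ∈ L) ∧ ∀ w, i w ∈ L → w ∈ Subgroup.normalClosure (Set.range f) := by
  obtain ⟨G, _, i, L, hG, hG', hi, hL, h⟩ := StackRule.exists_fg_mem_iff_eqvGen
    (finite_rules m main b₀ b₁ e code q₀ q₁) (.grow, withCounter [] (single main [b₁, e]))
  refine ⟨G, _, i, L, hG, hG', hi, hL, fun n => ?_, fun w hw => ?_⟩
  · rw [h]
    simpa only [FreeGroup.mk_toWord] using equivalent_of_reaches (hf n)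
  · have key {c c'} (hc : EqvGen (StackRule.Step (rules m main b₀ b₁ e code q₀ q₁)) c c') :
        Inv m main b₀ b₁ e code q₀ q₁ (Subgroup.normalClosure (Set.range f)) c ↔
        Inv m main b₀ b₁ e code q₀ q₁ (Subgroup.normalClosure (Set.range f)) c' := by
      induction hc with
      | rel _ _ h =>
        exact inv_iff_of_step h₀ h₁ h₂ hcode hq₁
          (fun n => Subgroup.subset_normalClosure (Set.mem_range_self n)) hf h
      | refl => rfl
      | symm _ _ _ ih => exact ih.symm
      | trans _ _ _ _ _ ih₁ ih₂ => exact ih₁.trans ih₂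
    have h' := (key ((h w).1 hw)).1 (by exact ⟨0, rfl, rfl, one_mem _⟩)
    obtain ⟨_, _, _, hw'⟩ := h'
    exact hw'

end StackMachine

theorem Turing.PartrecToTM2.trNat_two_mul_add_one (n : ℕ) :
    trNat (2 * n + 1) = Γ'.bit1 :: trNat n := by
  rw [trNat, trNat, ← Num.ofNat'_eq, ← Num.ofNat'_eq, ← Nat.bit_true_apply, Num.ofNat'_bit]
  cases Num.ofNat' n <;> rfl

theorem Turing.PartrecToTM2.trNat_two_mul {n : ℕ} (hn : n ≠ 0) :
    trNat (2 * n) = Γ'.bit0 :: trNat n := by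
  rw [trNat, trNat, ← Num.ofNat'_eq, ← Num.ofNat'_eq, ← Nat.bit_false_apply, Num.ofNat'_bit]
  have : Num.ofNat' n ≠ 0 := by
    rw [Num.ofNat'_eq]
    simpa using hn
  cases h : Num.ofNat' n with
  | zero => exact absurd h this
  | pos m => rfl

theorem Turing.PartrecToTM2.trNat_two_pow_mul {n : ℕ} (hn : n ≠ 0) (m : ℕ) :
    trNat (2 ^ m * n) = List.replicate m Γ'.bit0 ++ trNat n := by
  induction m with
  | zero => simp
  | succ m ih => rw [pow_succ', mul_assoc, trNat_two_mul (by positivity), ih]; rfl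

namespace StackMachine

section Restrict

variable {Q K Γ : Type} [DecidableEq K] (m : StackMachine Q K Γ) (T : Set Q)

open Classical in
/-- The restriction of a stack machine to a set of states. -/
noncomputable def restrict : StackMachine T K Γ where
  act q := m.act q
  δ q h := (m.δ q h).bind fun p => if hp : p.1 ∈ T then some (⟨p.1, hp⟩, p.2) else none

theorem reaches_restrict (hT : ∀ q ∈ T, ∀ h p, m.δ q h = some p → p.1 ∈ T)
    {c c' : Q × (K → List Γ)} (h : StateTransition.Reaches m.step c c') (hc : c.1 ∈ T) :
    ∃ hc' : c'.1 ∈ T,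
      StateTransition.Reaches (m.restrict T).step (⟨c.1, hc⟩, c.2) (⟨c'.1, hc'⟩, c'.2) := by
  induction h with
  | refl => exact ⟨hc, .refl⟩
  | @tail c' c'' _ h ih =>
    obtain ⟨hc', ih⟩ := ih
    simp only [step, Option.mem_def, Option.map_eq_some_iff] at h
    obtain ⟨p, hp, rfl⟩ := h
    refine ⟨hT _ hc' _ _ hp, ih.tail ?_⟩
    simp [step, restrict, hp, hT _ hc' _ _ hp]

end Restrict

section TM2

open Turing

variable {K Γ Λ σ : Type} (M : Λ → TM2.Stmt (fun _ : K => Γ) Λ σ)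

theorem apply_mem_stmts {S : Finset Λ} {l : Λ} (hl : l ∈ S) : some (M l) ∈ TM2.stmts M S := by
  simp only [TM2.stmts, Finset.some_mem_insertNone, Finset.mem_biUnion]
  exact ⟨l, hl, TM2.stmts₁_self⟩

variable [Inhabited K]

/-- The stack machine executing the statements of a `TM2` program one at a time. -/
def ofTM2 : StackMachine (TM2.Stmt (fun _ : K => Γ) Λ σ × σ) K Γ where
  act
    | (.push k _ _, _) => k
    | (.peek k _ _, _) => k
    | (.pop k _ _, _) => k
    | _ => default
  δ
    | (.push _ f q, v), h => some ((q, v), f v :: h.toList)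
    | (.peek _ f q, v), h => some ((q, f v h), h.toList)
    | (.pop _ f q, v), h => some ((q, f v h), [])
    | (.load a q, v), h => some ((q, a v), h.toList)
    | (.branch f q₁ q₂, v), h => some ((cond (f v) q₁ q₂, v), h.toList)
    | (.goto l, v), h => some ((M (l v), v), h.toList)
    | (.halt, _), _ => none

theorem mem_stmts_of_mem {S : Finset Λ} (hS : ∀ l ∈ S, TM2.SupportsStmt S (M l))
    (q : TM2.Stmt (fun _ : K => Γ) Λ σ × σ) (hq : some q.1 ∈ TM2.stmts M S) (h : Option Γ)
    (p) (hp : (ofTM2 M).δ q h = some p) : some p.1.1 ∈ TM2.stmts M S := by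
  obtain ⟨q, v⟩ := q
  have hs : TM2.SupportsStmt S q := by
    simp only [TM2.stmts, Finset.some_mem_insertNone, Finset.mem_biUnion] at hq
    obtain ⟨l, hl, hq⟩ := hq
    exact TM2.stmts₁_supportsStmt_mono hq (hS l hl)
  cases q with
  | goto l =>
    obtain rfl := Option.some_inj.1 hp
    exact apply_mem_stmts M (hs v)
  | halt => simp [ofTM2] at hp
  | branch f q₁ q₂ =>
    obtain rfl := Option.some_inj.1 hp
    refine TM2.stmts_trans ?_ hq
    cases f v <;> simp [TM2.stmts₁, TM2.stmts₁_self]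
  | _ =>
    obtain rfl := Option.some_inj.1 hp
    exact TM2.stmts_trans (by simp [TM2.stmts₁, TM2.stmts₁_self]) hq

variable [DecidableEq K]

/-- The configuration of the stack machine corresponding to a configuration of a `TM2` program. -/
def ofTM2Cfg (c : TM2.Cfg (fun _ : K => Γ) Λ σ) :
    (TM2.Stmt (fun _ : K => Γ) Λ σ × σ) × (K → List Γ) :=
  ((c.l.elim .halt M, c.var), c.stk)

theorem head?_toList_append_tail (l : List Γ) : l.head?.toList ++ l.tail = l := by
  cases l <;> rfl

theorem reaches_stepAux (q : TM2.Stmt (fun _ : K => Γ) Λ σ) (v : σ) (S : K → List Γ) :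
    StateTransition.Reaches (ofTM2 M).step ((q, v), S) (ofTM2Cfg M (TM2.stepAux q v S)) := by
  induction q generalizing v S with
  | push k f q ih =>
    refine .head ?_ (ih _ _)
    simp [step, ofTM2, head?_toList_append_tail]
  | peek k f q ih =>
    refine .head ?_ (ih _ _)
    simp [step, ofTM2, head?_toList_append_tail]
  | pop k f q ih =>
    refine .head ?_ (ih _ _)
    simp [step, ofTM2]
  | load a q ih =>
    refine .head ?_ (ih _ _)
    simp [step, ofTM2, head?_toList_append_tail]
  | branch f q₁ q₂ ih₁ ih₂ =>
    refine .head (b := ((cond (f v) q₁ q₂, v), S)) ?_ ?_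
    · simp [step, ofTM2, head?_toList_append_tail]
    · cases h : f v
      · simp only [h, TM2.stepAux, cond_false]
        exact ih₂ v S
      · simp only [h, TM2.stepAux, cond_true]
        exact ih₁ v S
  | goto l =>
    refine .single ?_
    simp [step, ofTM2, head?_toList_append_tail, ofTM2Cfg]
  | halt => exact .refl

theorem reaches_of_reaches {c c' : TM2.Cfg (fun _ : K => Γ) Λ σ}
    (h : StateTransition.Reaches (TM2.step M) c c') :
    StateTransition.Reaches (ofTM2 M).step (ofTM2Cfg M c) (ofTM2Cfg M c') := by
  induction h with
  | refl => exact .refl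
  | @tail c' c'' _ h ih =>
    refine ih.trans ?_
    obtain ⟨_ | l, v, S⟩ := c'
    · simp at h
    · simp only [TM2.step, Option.mem_def, Option.some.injEq] at h
      exact h ▸ reaches_stepAux M (M l) v S

end TM2

end StackMachine

section Encoding

open Turing.PartrecToTM2

variable {B : Type} [Encodable B]

/-- The number whose binary expansion is the prefix code of a word. -/
def wordNumber (l : List (B × Bool)) : ℕ :=
  l.foldr (fun x n => 2 ^ Encodable.encode x * (2 * n + 1)) 0

theorem trNat_wordNumber (l : List (B × Bool)) : trNat (wordNumber l) ++ [Γ'.cons] =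
    StackMachine.codeWord Γ'.bit0 Γ'.bit1 Γ'.cons Encodable.encode l := by
  induction l with
  | nil => simp [wordNumber, StackMachine.codeWord]
  | cons x l ih =>
    rw [StackMachine.codeWord, ← ih, wordNumber, List.foldr_cons, trNat_two_pow_mul (by omega),
      trNat_two_mul_add_one, List.append_assoc]
    rfl

theorem primrec_pow : Primrec₂ ((· ^ ·) : ℕ → ℕ → ℕ) :=
  Primrec₂.unpaired'.1 Nat.Primrec.pow

end Encoding

theorem primrec_wordNumber {B : Type} [Primcodable B] :
    Primrec (wordNumber : List (B × Bool) → ℕ) := by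
  refine Primrec.list_foldr (f := fun l : List (B × Bool) => l) (g := fun _ => 0)
    (h := fun _ p => 2 ^ Encodable.encode p.1 * (2 * p.2 + 1)) Primrec.id (Primrec.const 0) ?_
  refine (Primrec.nat_mul.comp (primrec_pow.comp (Primrec.const 2)
    (Primrec.encode.comp (Primrec.fst.comp Primrec.snd)))
    (Primrec.succ.comp (Primrec.nat_mul.comp (Primrec.const 2)
      (Primrec.snd.comp Primrec.snd)))).to₂

theorem exists_primrec_two_pow : ∃ g : ℕ → ℕ, Primrec g ∧ ∀ n, g (2 ^ n) = n := by
  refine ⟨fun x => x.findGreatest fun n => 2 ^ n ≤ x, Primrec.nat_findGreatest Primrec.id ?_,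
    fun n => ?_⟩
  · exact Primrec.nat_le.comp₂ (primrec_pow.comp (Primrec.const 2) Primrec.snd).to₂ Primrec₂.left
  · rw [Nat.findGreatest_eq_iff]
    refine ⟨n.lt_two_pow_self.le, fun _ => le_rfl, fun k hk _ => ?_⟩
    rw [not_le]
    exact Nat.pow_lt_pow_right one_lt_two hk

/-- A recursively enumerable set of words can be carved out of a finitely presented torsion-free
group containing the free group by a finitely generated subgroup, up to normal closure. -/
theorem exists_fg_comap_of_computable {B : Type} [Finite B] [DecidableEq B] [Primcodable B]
    {f : ℕ → FreeGroup B} (hf : Computable fun n => (f n).toWord) :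
    ∃ (G : Type) (_ : Group G) (i : FreeGroup B →* G) (L : Subgroup G),
      Group.IsFinitelyPresented G ∧ NoTorsion G ∧ Function.Injective i ∧ L.FG ∧
      (∀ n, i (f n) ∈ L) ∧ ∀ w, i w ∈ L → w ∈ Subgroup.normalClosure (Set.range f) := by
  classical
  obtain ⟨g, hg, hg'⟩ := exists_primrec_two_pow
  have hF : Computable fun m => wordNumber (f (g m)).toWord :=
    primrec_wordNumber.to_comp.comp (hf.comp hg.to_comp)
  obtain ⟨c, hc⟩ := Turing.ToPartrec.Code.exists_code (Nat.Partrec'.part_iff₁.2 hF.partrec)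
  have hS := Turing.PartrecToTM2.tr_supports c .halt
  set S := Turing.PartrecToTM2.codeSupp c .halt
  let T : Set (Turing.TM2.Stmt (fun _ : Turing.PartrecToTM2.K' => Turing.PartrecToTM2.Γ')
      Turing.PartrecToTM2.Λ' (Option Turing.PartrecToTM2.Γ') × Option Turing.PartrecToTM2.Γ') :=
    {q | some q.1 ∈ Turing.TM2.stmts Turing.PartrecToTM2.tr S}
  have hT : T.Finite := by
    refine Set.Finite.subset (((Turing.TM2.stmts Turing.PartrecToTM2.tr S).finite_toSet.preimage
      (Option.some_injective _).injOn).prod Set.finite_univ) fun q hq => ⟨hq, Set.mem_univ _⟩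
  have := hT.to_subtype
  have : Finite Turing.PartrecToTM2.K' := by
    refine .of_surjective (α := Fin 4) ![.main, .rev, .aux, .stack] ?_
    rintro (_ | _ | _ | _)
    exacts [⟨0, rfl⟩, ⟨1, rfl⟩, ⟨2, rfl⟩, ⟨3, rfl⟩]
  have hmem : (Turing.PartrecToTM2.tr (Turing.PartrecToTM2.trNormal c .halt),
      (none : Option Turing.PartrecToTM2.Γ')) ∈ T := by
    have h : Turing.PartrecToTM2.trNormal c .halt ∈ S := hS.1
    exact StackMachine.apply_mem_stmts Turing.PartrecToTM2.tr h
  have key (n : ℕ) := by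
    have h : Turing.PartrecToTM2.halt [wordNumber (f n).toWord] ∈ StateTransition.eval
        (Turing.TM2.step Turing.PartrecToTM2.tr) (Turing.PartrecToTM2.init c [2 ^ n]) := by
      rw [Turing.PartrecToTM2.tr_eval, show [2 ^ n] = (2 ^ n ::ᵥ List.Vector.nil).1 from rfl, hc]
      simp only [hg', Part.map_eq_map, List.Vector.head_cons, PFun.coe_val, Part.map_some, pure]
      exact Part.mem_some _
    exact StackMachine.reaches_restrict (StackMachine.ofTM2 Turing.PartrecToTM2.tr) T
      (fun q hq h p => StackMachine.mem_stmts_of_mem _ hS.2 q hq h p)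
      (StackMachine.reaches_of_reaches _ (StateTransition.mem_eval.1 h).1) hmem
  refine StackMachine.exists_fg_comap_eq (code := Encodable.encode) (f := f)
    (m := (StackMachine.ofTM2 Turing.PartrecToTM2.tr).restrict T)
    (main := Turing.PartrecToTM2.K'.main)
    (b₀ := .bit0) (b₁ := .bit1) (e := .cons) (q₀ := ⟨_, hmem⟩) (q₁ := ⟨_, (key 0).1⟩) (by simp)
    (by simp) (by simp) Encodable.encode_injective (fun _ => rfl) fun n => ?_
  have h₁ := trNat_wordNumber (f n).toWord
  have h₂ : Turing.PartrecToTM2.trNat (2 ^ n) = List.replicate n .bit0 ++ [.bit1] := by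
    rw [← mul_one (2 ^ n), Turing.PartrecToTM2.trNat_two_pow_mul one_ne_zero]
    rfl
  convert (key n).2 using 2
  · rfl
  · funext k
    cases k
    · simp [StackMachine.ofTM2Cfg, Turing.PartrecToTM2.init, h₂]
    all_goals rfl
  · rfl
  · funext k
    cases k
    · simpa [StackMachine.ofTM2Cfg, Turing.PartrecToTM2.halt] using h₁.symm
    all_goals rfl

section Tor

theorem tor_normal (G : Type*) [Group G] : ∀ m, (tor G m).Normal
  | 0 => inferInstanceAs (⊥ : Subgroup G).Normal
  | _ + 1 => Subgroup.normalClosure_normal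

theorem tor_eq_normalClosure_and_comap_tor_eq {C H : Type*} [Group C] [Group H] {ι : C →* H}
    (hι : ∀ N : Subgroup C, N.Normal → (Subgroup.normalClosure (ι '' (N : Set C))).comap ι = N)
    (hpow : ∀ N : Subgroup C, N.Normal → ∀ (g : H) (k : ℕ), 0 < k →
      g ^ k ∈ Subgroup.normalClosure (ι '' (N : Set C)) → ∃ d c, c ^ k ∈ N ∧
        g * (d * ι c * d⁻¹)⁻¹ ∈ Subgroup.normalClosure (ι '' (N : Set C))) (m : ℕ) :
    tor H m = Subgroup.normalClosure (ι '' (tor C m : Set C)) ∧ (tor H m).comap ι = tor C m := by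
  suffices h : tor H m = Subgroup.normalClosure (ι '' (tor C m : Set C)) from
    ⟨h, by rw [h, hι _ (tor_normal C m)]⟩
  induction m with
  | zero =>
    have := tor_normal H 0
    refine le_antisymm bot_le (Subgroup.normalClosure_le_normal ?_)
    rintro _ ⟨c, hc, rfl⟩
    obtain rfl : c = 1 := Subgroup.mem_bot.1 hc
    simp
  | succ m ih =>
    have hle : tor C m ≤ tor C (m + 1) := fun x hx =>
      Subgroup.subset_normalClosure ⟨1, one_pos, by simpa using hx⟩
    apply le_antisymm
    · refine Subgroup.normalClosure_le_normal ?_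
      rintro g ⟨k, hk, hg⟩
      rw [ih] at hg
      obtain ⟨d, c, hc, h⟩ := hpow _ (tor_normal C m) g k hk hg
      have h1 := Subgroup.normalClosure_mono (Set.image_mono (f := ι) hle) h
      have h2 : ι c ∈ Subgroup.normalClosure (ι '' (tor C (m + 1) : Set C)) :=
        Subgroup.subset_normalClosure ⟨c, Subgroup.subset_normalClosure ⟨k, hk, hc⟩, rfl⟩
      have := mul_mem h1 (Subgroup.normalClosure_normal.conj_mem _ h2 d)
      rwa [inv_mul_cancel_right] at this
    · have hn := tor_normal H (m + 1)
      refine Subgroup.normalClosure_le_normal ?_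
      rintro _ ⟨c, hc, rfl⟩
      have : tor C (m + 1) ≤ (tor H (m + 1)).comap ι := by
        refine Subgroup.normalClosure_le_normal ?_
        rintro c ⟨k, hk, hc⟩
        refine Subgroup.subset_normalClosure ⟨k, hk, ?_⟩
        rw [← map_pow, ih]
        exact Subgroup.subset_normalClosure ⟨_, hc, rfl⟩
      exact this hc

end Tor

namespace HNNExtension

variable {E C : Type*} [Group E] [Group C] {Γ : Subgroup (E × C)}

theorem rope_left_injective (hΓ : ∀ c, ((1 : E), c) ∈ Γ → c = 1) (Q : Type*) [Group Q] :
    Function.Injective ((MonoidHom.inl E Q).comp ((MonoidHom.fst E C).comp Γ.subtype)) := by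
  rw [injective_iff_map_eq_one]
  rintro ⟨⟨e, c⟩, h⟩ h1
  obtain rfl : e = 1 := by simpa using h1
  simpa using hΓ c h

theorem rope_right_injective (hΓ : ∀ c, ((1 : E), c) ∈ Γ → c = 1) {Q : Type*} [Group Q]
    (q : C →* Q) :
    Function.Injective (((MonoidHom.id E).prodMap q).comp Γ.subtype) := by
  rw [injective_iff_map_eq_one]
  rintro ⟨⟨e, c⟩, h⟩ h1
  obtain rfl : e = 1 := by
    have := congrArg Prod.fst h1
    simpa using this
  simpa using hΓ c h

/-- The HNN extension of `E × Q` whose stable letter conjugates `(e, 1)` to `(e, q c)` for all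
`(e, c) ∈ Γ`. -/
abbrev Rope (hΓ : ∀ c, ((1 : E), c) ∈ Γ → c = 1) {Q : Type*} [Group Q] (q : C →* Q) :=
  OfHoms _ _ (rope_left_injective hΓ Q) (rope_right_injective hΓ q)

namespace Rope

variable {hΓ : ∀ c, ((1 : E), c) ∈ Γ → c = 1}

theorem t_mul {Q : Type*} [Group Q] (q : C →* Q) {e : E} {c : C} (h : (e, c) ∈ Γ) :
    (t * of (e, 1) : Rope hΓ q) = of (e, q c) * t :=
  OfHoms.t_mul_of_left (h₁ := rope_left_injective hΓ Q) (h₂ := rope_right_injective hΓ q)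
    ⟨(e, c), h⟩

variable (hΓ) in
/-- The embedding of `C` into the rope group. -/
noncomputable def ι : C →* Rope hΓ (MonoidHom.id C) := of.comp (MonoidHom.inr E C)

theorem ι_injective : Function.Injective (ι hΓ) := by
  refine (of_injective _).comp ?_
  intro a b h
  simpa using h

variable (hΓ) in
/-- The homomorphism of rope groups induced by a quotient map. -/
noncomputable def map (N : Subgroup C) [N.Normal] :
    Rope hΓ (MonoidHom.id C) →* Rope hΓ (QuotientGroup.mk' N) :=
  OfHoms.desc _ _ (of.comp ((MonoidHom.id E).prodMap (QuotientGroup.mk' N))) t (by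
    rintro ⟨⟨e, c⟩, h⟩
    simpa using t_mul (QuotientGroup.mk' N) h)

variable {N : Subgroup C} [N.Normal]

theorem map_of (e : E) (c : C) : map hΓ N (of (e, c)) = of (e, (c : C ⧸ N)) :=
  OfHoms.desc_of _ _ _ _

theorem map_t : map hΓ N t = t := OfHoms.desc_t _ _ _

theorem map_ι (c : C) : map hΓ N (ι hΓ c) = of (1, (c : C ⧸ N)) := map_of _ _

theorem map_surjective : Function.Surjective (map hΓ N) := by
  rw [← MonoidHom.range_eq_top, eq_top_iff, ← OfHoms.closure_of_t, Subgroup.closure_le]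
  rintro _ (⟨⟨e, c⟩, -, rfl⟩ | rfl)
  · obtain ⟨c, rfl⟩ := QuotientGroup.mk_surjective c
    exact ⟨of (e, c), map_of e c⟩
  · exact ⟨t, map_t⟩

theorem ker_map : (map hΓ N).ker = Subgroup.normalClosure (ι hΓ '' (N : Set C)) := by
  apply le_antisymm
  · let q := QuotientGroup.mk' (Subgroup.normalClosure (ι hΓ '' (N : Set C)))
    let fE : E →* _ := q.comp (of.comp (MonoidHom.inl E C))
    let fC : C ⧸ N →* _ := QuotientGroup.lift N (q.comp (ι hΓ)) fun c hc =>
      (QuotientGroup.eq_one_iff _).2 (Subgroup.subset_normalClosure ⟨c, hc, rfl⟩)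
    have hfC (c : C) : fC c = q (of (1, c)) := rfl
    have hfE (e : E) : fE e = q (of (e, 1)) := rfl
    have hc : ∀ e c, Commute (fE e) (fC c) := by
      intro e c
      obtain ⟨c, rfl⟩ := QuotientGroup.mk_surjective c
      rw [hfC, hfE, Commute, SemiconjBy, ← map_mul, ← map_mul, ← map_mul, ← map_mul]
      simp
    have hp (e : E) (c : C) : fE.noncommCoprod fC hc (e, (c : C ⧸ N)) = q (of (e, c)) := by
      rw [MonoidHom.noncommCoprod_apply, hfC, hfE, ← map_mul, ← map_mul]
      simp
    let Ψ : Rope hΓ (QuotientGroup.mk' N) →* _ := OfHoms.desc _ _ (fE.noncommCoprod fC hc) (q t) (by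
      rintro ⟨⟨e, c⟩, h⟩
      have h1 := hp e 1
      have h2 := hp e c
      have h3 := congrArg q (t_mul (hΓ := hΓ) (MonoidHom.id C) h)
      rw [map_mul, map_mul, MonoidHom.id_apply, ← h1, ← h2] at h3
      exact h3)
    have hΨ : Ψ.comp (map hΓ N) = q := by
      refine HNNExtension.hom_ext ?_ ?_
      · refine MonoidHom.ext ?_
        rintro ⟨e, c⟩
        change Ψ (map hΓ N (of (e, c))) = q (of (e, c))
        rw [map_of, ← hp]
        exact OfHoms.desc_of _ _ _ _
      · change Ψ (map hΓ N t) = q t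
        rw [map_t]
        exact OfHoms.desc_t _ _ _
    intro x hx
    refine (QuotientGroup.eq_one_iff x).1 ?_
    have h1 : Ψ (map hΓ N x) = q x := DFunLike.congr_fun hΨ x
    rw [MonoidHom.mem_ker.1 hx, map_one] at h1
    exact h1.symm
  · refine Subgroup.normalClosure_le_normal ?_
    rintro _ ⟨c, hc, rfl⟩
    rw [SetLike.mem_coe, MonoidHom.mem_ker, map_ι, (QuotientGroup.eq_one_iff c).2 hc]
    exact map_one _

theorem comap_normalClosure :
    (Subgroup.normalClosure (ι hΓ '' (N : Set C))).comap (ι hΓ) = N := by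
  ext c
  rw [Subgroup.mem_comap, ← ker_map, MonoidHom.mem_ker, map_ι,
    map_eq_one_iff _ (of_injective _), Prod.mk_eq_one, QuotientGroup.eq_one_iff]
  simp

theorem exists_conj_of_pow_mem (hE : NoTorsion E) {g : Rope hΓ (MonoidHom.id C)} {k : ℕ}
    (hk : 0 < k) (hg : g ^ k ∈ Subgroup.normalClosure (ι hΓ '' (N : Set C))) :
    ∃ d c, c ^ k ∈ N ∧
      g * (d * ι hΓ c * d⁻¹)⁻¹ ∈ Subgroup.normalClosure (ι hΓ '' (N : Set C)) := by
  rw [← ker_map, MonoidHom.mem_ker, map_pow] at hg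
  obtain ⟨d, ⟨e, c⟩, h⟩ := OfHoms.exists_conj_of_pow_eq_one hk hg
  obtain ⟨d, rfl⟩ := map_surjective (hΓ := hΓ) d
  obtain ⟨c, rfl⟩ := QuotientGroup.mk_surjective c
  rw [h, conj_pow, conj_eq_one_iff, ← map_pow, map_eq_one_iff _ (of_injective _), Prod.pow_mk,
    Prod.mk_eq_one] at hg
  obtain rfl := hE e k hk hg.1
  refine ⟨d, c, (QuotientGroup.eq_one_iff _).1 (by simpa using hg.2), ?_⟩
  rw [← ker_map, MonoidHom.mem_ker, map_mul, map_inv, map_mul, map_mul, map_ι, map_inv, h]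
  simp

end Rope

end HNNExtension

namespace HNNExtension.Rope

/-- The subgroup of `E × C` generated by the pairs `(a w, w)` and `(a' w, 1)` for all words `w`. -/
def graph {E : Type*} [Group E] {B : Type*} {R : Set (FreeGroup B)} (a a' : FreeGroup B →* E) :
    Subgroup (E × PresentedGroup R) :=
  (a.prod (PresentedGroup.mk R)).range ⊔ (a'.prod 1).range

theorem isFinitelyPresented {E : Type*} [Group E] [Group.IsFinitelyPresented E] {B : Type*}
    [Finite B] {R : Set (FreeGroup B)} {a a' : FreeGroup B →* E} (haa : ∀ r ∈ R, a r = a' r)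
    (hΓ : ∀ c : PresentedGroup R, ((1 : E), c) ∈ graph a a' → c = 1) :
    Group.IsFinitelyPresented (Rope hΓ (MonoidHom.id (PresentedGroup R))) := by
  obtain ⟨T, hT⟩ := (Group.IsFinitelyPresented.fg (G := E)).out
  let x (b : B) : Monoid.Coprod E (FreeGroup (Option B)) := .inr (.of (some b))
  let y : Monoid.Coprod E (FreeGroup (Option B)) := .inr (.of none)
  let S : Set (Monoid.Coprod E (FreeGroup (Option B))) :=
    (fun p : E × B => .inl p.1 * x p.2 * (.inl p.1)⁻¹ * (x p.2)⁻¹) '' (↑T ×ˢ Set.univ) ∪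
      (Set.range (fun b : B => y * .inl (a (.of b)) * y⁻¹ * (.inl (a (.of b)) * x b)⁻¹) ∪
      Set.range (fun b : B => y * .inl (a' (.of b)) * y⁻¹ * (.inl (a' (.of b)))⁻¹))
  have hS : S.Finite := ((T.finite_toSet.prod Set.finite_univ).image _).union
    ((Set.finite_range _).union (Set.finite_range _))
  let q := QuotientGroup.mk' (Subgroup.normalClosure S)
  have hq {s : Monoid.Coprod E (FreeGroup (Option B))} (hs : s ∈ S) : q s = 1 :=
    (QuotientGroup.eq_one_iff _).2 (Subgroup.subset_normalClosure hs)
  let fE : E →* Monoid.Coprod E (FreeGroup (Option B)) ⧸ Subgroup.normalClosure S :=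
    q.comp Monoid.Coprod.inl
  let fF : FreeGroup B →* Monoid.Coprod E (FreeGroup (Option B)) ⧸ Subgroup.normalClosure S :=
    FreeGroup.lift fun b => q (x b)
  have hcomm : ∀ e w, Commute (fE e) (fF w) := by
    have h1 (b : B) (e : E) : Commute (fE e) (q (x b)) := by
      have : (MulAut.conj (q (x b))).toMonoidHom.comp fE = fE := by
        refine MonoidHom.eq_of_eqOn_dense hT fun e he => ?_
        have := hq (.inl ⟨(e, b), ⟨he, trivial⟩, rfl⟩)
        simp only [map_mul, map_inv] at this
        rw [mul_inv_eq_one, mul_inv_eq_iff_eq_mul] at this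
        change q (x b) * fE e * (q (x b))⁻¹ = fE e
        rw [mul_inv_eq_iff_eq_mul]
        exact this.symm
      have := DFunLike.congr_fun this e
      exact (mul_inv_eq_iff_eq_mul.1 this).symm
    intro e w
    have : (MulAut.conj (fE e)).toMonoidHom.comp fF = fF := by
      ext b
      change fE e * fF (.of b) * (fE e)⁻¹ = fF (.of b)
      rw [mul_inv_eq_iff_eq_mul, FreeGroup.lift_apply_of]
      exact h1 b e
    exact mul_inv_eq_iff_eq_mul.1 (DFunLike.congr_fun this w)
  have ha (w) : q y * fE (a w) * (q y)⁻¹ = fE (a w) * fF w := by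
    have : ((MulAut.conj (q y)).toMonoidHom.comp fE).comp a =
        (fE.noncommCoprod fF hcomm).comp (a.prod (MonoidHom.id _)) := by
      ext b
      have := hq (.inr (.inl ⟨b, rfl⟩))
      simp only [map_mul, map_inv] at this
      rw [mul_inv_eq_one] at this
      change q y * fE (a (.of b)) * (q y)⁻¹ = fE (a (.of b)) * fF (.of b)
      rw [FreeGroup.lift_apply_of]
      exact this
    exact DFunLike.congr_fun this w
  have ha' (w) : q y * fE (a' w) * (q y)⁻¹ = fE (a' w) := by
    have : ((MulAut.conj (q y)).toMonoidHom.comp fE).comp a' = fE.comp a' := by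
      ext b
      have := hq (.inr (.inr ⟨b, rfl⟩))
      simp only [map_mul, map_inv] at this
      rw [mul_inv_eq_one] at this
      exact this
    exact DFunLike.congr_fun this w
  let fC : PresentedGroup R →* Monoid.Coprod E (FreeGroup (Option B)) ⧸ Subgroup.normalClosure S :=
    PresentedGroup.toGroup (f := fun b => q (x b)) fun r hr => by
      have h := ha r
      rw [haa r hr, ha'] at h
      exact left_eq_mul.1 h
  have hcommC : ∀ e c, Commute (fE e) (fC c) := by
    intro e c
    obtain ⟨w, rfl⟩ := PresentedGroup.mk_surjective R c
    exact hcomm e w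
  have hdesc : graph a a' ≤
      ((MulAut.conj (q y)).toMonoidHom.comp (fE.comp (MonoidHom.fst E _))).eqLocus
        (fE.noncommCoprod fC hcommC) := by
    refine sup_le ?_ ?_
    · rintro _ ⟨w, rfl⟩
      exact ha w
    · rintro _ ⟨w, rfl⟩
      change q y * fE (a' w) * (q y)⁻¹ = fE (a' w) * fC 1
      rw [map_one, mul_one]
      exact ha' w
  let g : Rope hΓ (MonoidHom.id _) →*
      Monoid.Coprod E (FreeGroup (Option B)) ⧸ Subgroup.normalClosure S :=
    OfHoms.desc _ _ (fE.noncommCoprod fC hcommC) (q y) (by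
      rintro ⟨⟨e, c⟩, h⟩
      have h1 : q y * fE e * (q y)⁻¹ = fE e * fC c := hdesc h
      rw [mul_inv_eq_iff_eq_mul] at h1
      change q y * (fE e * fC 1) = fE e * fC c * q y
      rw [map_one, mul_one, h1])
  have hgof (p) : g (of p) = fE p.1 * fC p.2 := OfHoms.desc_of _ _ _ _
  have hgt : g t = q y := OfHoms.desc_t _ _ _
  let f : Monoid.Coprod E (FreeGroup (Option B)) →* Rope hΓ (MonoidHom.id _) :=
    Monoid.Coprod.lift (of.comp (MonoidHom.inl _ _))
      (FreeGroup.lift fun o => o.elim t fun b => of (1, PresentedGroup.of b))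
  have hfinl (e) : f (.inl e) = of (e, 1) := rfl
  have hfx (b) : f (x b) = of (1, PresentedGroup.of b) := by simp [f, x]
  have hfy : f y = t := by simp [f, y]
  refine Group.IsFinitelyPresented.of_section f ?_ hS ?_ g ?_
  · rw [← MonoidHom.range_eq_top, eq_top_iff, ← OfHoms.closure_of_t, Subgroup.closure_le]
    rintro _ (⟨⟨e, c⟩, -, rfl⟩ | rfl)
    · obtain ⟨w, rfl⟩ := PresentedGroup.mk_surjective R c
      have h : (f.comp Monoid.Coprod.inr).comp (FreeGroup.map some) =
          (of.comp (MonoidHom.inr E _)).comp (PresentedGroup.mk R) := by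
        ext b
        exact hfx b
      refine ⟨.inl e * .inr (FreeGroup.map some w), ?_⟩
      have h1 : f (.inr (FreeGroup.map some w)) = of (1, PresentedGroup.mk R w) :=
        DFunLike.congr_fun h w
      rw [map_mul, hfinl, h1, ← map_mul]
      simp
    · exact ⟨y, hfy⟩
  · have hmem (w) : (a w, PresentedGroup.mk R w) ∈ graph (R := R) a a' :=
      Subgroup.mem_sup_left ⟨w, rfl⟩
    have hmem' (w) : (a' w, (1 : PresentedGroup R)) ∈ graph (R := R) a a' :=
      Subgroup.mem_sup_right ⟨w, rfl⟩
    rintro _ (⟨⟨e, b⟩, -, rfl⟩ | ⟨b, rfl⟩ | ⟨b, rfl⟩)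
    · simp only [map_mul, map_inv, hfinl, hfx]
      simp only [← map_mul, ← map_inv]
      refine (congrArg of ?_).trans (map_one of)
      simp
    · simp only [map_mul, map_inv, hfinl, hfx, hfy]
      rw [t_mul _ (hmem _), ← map_mul, mul_inv_cancel_right, ← map_inv, ← map_mul]
      refine (congrArg of ?_).trans (map_one of)
      simp [PresentedGroup.of]
    · simp only [map_mul, map_inv, hfinl, hfy]
      rw [t_mul _ (hmem' _), mul_inv_cancel_right, ← map_inv, ← map_mul]
      refine (congrArg of ?_).trans (map_one of)
      simp
  · refine DFunLike.congr_fun (f := g.comp f) (g := q) ?_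
    refine Monoid.Coprod.hom_ext ?_ ?_
    · ext e
      change g (f (.inl e)) = fE e
      simp [hfinl, hgof]
    · ext o
      cases o with
      | none =>
        change g (f y) = q y
        rw [hfy, hgt]
      | some b =>
        change g (f (x b)) = q (x b)
        rw [hfx, hgof, map_one, one_mul]
        exact FreeGroup.lift_apply_of

end HNNExtension.Rope

/-- In the HNN extension of `K` in which the stable letter centralises `L`, the pairs `(w, w)` and
`(t * w * t⁻¹, 1)` generate the graph of a homomorphism to `C`, if `w` is trivial in `C` whenever
it lies in `L`. -/
theorem HNNExtension.Rope.eq_one_of_mem_graph {B : Type*} {R : Set (FreeGroup B)} {K : Type*}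
    [Group K] {i : FreeGroup B →* K} (hi : Function.Injective i) {L : Subgroup K}
    (hL : ∀ w, i w ∈ L → PresentedGroup.mk R w = 1)
    (c : PresentedGroup R)
    (hc : ((1 : OfHoms L.subtype L.subtype L.subtype_injective L.subtype_injective), c) ∈
      graph (of.comp i) ((MulAut.conj t).toMonoidHom.comp (of.comp i))) : c = 1 := by
  let Z := L.prod (⊤ : Subgroup (PresentedGroup R))
  let E := OfHoms L.subtype L.subtype L.subtype_injective L.subtype_injective
  let E' := OfHoms Z.subtype Z.subtype Z.subtype_injective Z.subtype_injective
  have ht : ∀ z ∈ Z, (t : E') * of z = of z * t := fun z hz =>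
    OfHoms.t_mul_of_left (h₁ := Z.subtype_injective) (h₂ := Z.subtype_injective) ⟨z, hz⟩
  let θ : E →* E' := OfHoms.desc _ _ (of.comp (MonoidHom.inl K _)) t fun z =>
    ht (z, 1) ⟨z.2, trivial⟩
  have hθ (k) : θ (of k) = of (k, 1) := OfHoms.desc_of _ _ _ _
  have hθt : θ t = t := OfHoms.desc_t _ _ _
  let fC : PresentedGroup R →* E' := of.comp (MonoidHom.inr K _)
  have hcomm : ∀ x c, Commute (θ x) (fC c) := by
    intro x c
    have : (MulAut.conj (fC c)).toMonoidHom.comp θ = θ := by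
      refine hom_ext ?_ ?_
      · ext k
        change fC c * θ (of k) * (fC c)⁻¹ = θ (of k)
        rw [hθ, mul_inv_eq_iff_eq_mul]
        change of (1, c) * of (k, 1) = of (k, 1) * of (1, c)
        rw [← map_mul, ← map_mul]
        simp
      · change fC c * θ t * (fC c)⁻¹ = θ t
        rw [hθt, mul_inv_eq_iff_eq_mul]
        exact (ht (1, c) ⟨one_mem L, trivial⟩).symm
    exact (mul_inv_eq_iff_eq_mul.1 (DFunLike.congr_fun this x)).symm
  let M₀ : Subgroup (K × PresentedGroup R) := (i.prod (PresentedGroup.mk R)).range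
  let M₁ : Subgroup (K × PresentedGroup R) := (i.prod 1).range
  have hle : graph (R := R) (of.comp i) ((MulAut.conj t).toMonoidHom.comp (of.comp i)) ≤
      (Subgroup.closure (of '' (M₀ : Set (K × PresentedGroup R)) ∪
        (fun x => (t : E') * of x * t⁻¹) '' (M₁ : Set (K × PresentedGroup R)))).comap
          (θ.noncommCoprod fC hcomm) := by
    refine sup_le ?_ ?_
    · rintro _ ⟨w, rfl⟩
      refine Subgroup.subset_closure (.inl ⟨(i w, PresentedGroup.mk R w), ⟨w, rfl⟩, ?_⟩)
      change _ = θ (of (i w)) * of (1, PresentedGroup.mk R w)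
      rw [hθ, ← map_mul]
      simp
    · rintro _ ⟨w, rfl⟩
      refine Subgroup.subset_closure (.inr ⟨(i w, 1), ⟨w, rfl⟩, ?_⟩)
      change _ = θ (t * of (i w) * t⁻¹) * fC 1
      rw [map_one, mul_one, map_mul, map_mul, map_inv, hθ, hθt]
  have h1 := hle hc
  have h2 : θ.noncommCoprod fC hcomm (1, c) = of (1, c) := by
    change θ 1 * of (1, c) = _
    rw [map_one, one_mul]
  rw [Subgroup.mem_comap, h2] at h1
  obtain ⟨w, hw⟩ := OfHoms.mem_of_of_mem_closure_conj (h₁ := Z.subtype_injective)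
    (h₂ := Z.subtype_injective) (M₀ := M₀) (M₁ := M₁) (by
      rintro ⟨⟨l, c⟩, hl, -⟩
      constructor
      · rintro ⟨w, hw⟩
        refine ⟨w, ?_⟩
        obtain ⟨h1, h2⟩ := Prod.mk.inj hw
        exact Prod.ext h1 ((hL w (by rw [h1]; exact hl)).trans h2)
      · rintro ⟨w, hw⟩
        refine ⟨w, ?_⟩
        obtain ⟨h1, h2⟩ := Prod.mk.inj hw
        exact Prod.ext h1 ((hL w (by rw [h1]; exact hl)).symm.trans h2)) h1
  obtain ⟨h3, h4⟩ := Prod.mk.inj hw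
  obtain rfl : w = 1 := hi (h3.trans (map_one i).symm)
  rw [← h4, map_one]

/-- A recursively presented group embeds into a finitely presented group in which every element of
finite order modulo the normal closure of a normal subgroup is conjugate to an element of the
recursively presented group. -/
theorem exists_finitelyPresented_embedding {k : ℕ} {f : ℕ → FreeGroup (Fin k)}
    (hf : Computable fun n => (f n).toWord) :
    ∃ (H : Type) (_ : Group H) (ι : PresentedGroup (Set.range f) →* H),
      Group.IsFinitelyPresented H ∧ Function.Injective ι ∧
      (∀ N : Subgroup (PresentedGroup (Set.range f)), N.Normal →
        (Subgroup.normalClosure (ι '' (N : Set _))).comap ι = N) ∧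
      ∀ N : Subgroup (PresentedGroup (Set.range f)), N.Normal → ∀ (g : H) (k : ℕ), 0 < k →
        g ^ k ∈ Subgroup.normalClosure (ι '' (N : Set _)) → ∃ d c, c ^ k ∈ N ∧
          g * (d * ι c * d⁻¹)⁻¹ ∈ Subgroup.normalClosure (ι '' (N : Set _)) := by
  obtain ⟨K, _, i, L, _, hK, hi, hLfg, hfL, hL⟩ := exists_fg_comap_of_computable hf
  have : Group.FG L := (Group.fg_iff_subgroup_fg L).2 hLfg
  have : Group.IsFinitelyPresented (HNNExtension.OfHoms L.subtype L.subtype L.subtype_injective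
    L.subtype_injective) := HNNExtension.OfHoms.isFinitelyPresented
  have hE := HNNExtension.OfHoms.noTorsion (j₁ := L.subtype) (j₂ := L.subtype)
    (h₁ := L.subtype_injective) (h₂ := L.subtype_injective) hK
  have hΓ := HNNExtension.Rope.eq_one_of_mem_graph (R := Set.range f) hi (L := L)
    fun w hw => (QuotientGroup.eq_one_iff w).2 (hL w hw)
  refine ⟨_, _, HNNExtension.Rope.ι hΓ, HNNExtension.Rope.isFinitelyPresented ?_ hΓ,
    HNNExtension.Rope.ι_injective, fun N _ => HNNExtension.Rope.comap_normalClosure,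
    fun N _ g k => HNNExtension.Rope.exists_conj_of_pow_mem hE⟩
  rintro _ ⟨n, rfl⟩
  have := HNNExtension.OfHoms.t_mul_of_left (h₁ := L.subtype_injective)
    (h₂ := L.subtype_injective) ⟨_, hfL n⟩
  exact (mul_inv_eq_iff_eq_mul.2 this).symm

/-- The Aanderaa–Cohen version of the Higman embedding preserves the torsion chain:
any finitely generated recursively presented group `C` embeds, via some `ι`, into a
finitely presented group `H` in such a way that `tor_m(H) = ⟪ι(tor_m C)⟫^H` and
`ι⁻¹(tor_m H) = tor_m C` for all `m`. -/
theorem higman_embedding_tor_chain (k : ℕ) (R : Set (FreeGroup (Fin k)))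
    (hR : ∃ f : ℕ → FreeGroup (Fin k), R = Set.range f ∧
      Computable fun n => (f n).toWord) :
    ∃ (j : ℕ) (S : Finset (FreeGroup (Fin j)))
      (ι : PresentedGroup R →* PresentedGroup (S : Set (FreeGroup (Fin j)))),
      Function.Injective ι ∧
      ∀ m : ℕ,
        tor (PresentedGroup (S : Set (FreeGroup (Fin j)))) m =
            Subgroup.normalClosure (ι '' (tor (PresentedGroup R) m : Set (PresentedGroup R))) ∧
          (tor (PresentedGroup (S : Set (FreeGroup (Fin j)))) m).comap ι =
            tor (PresentedGroup R) m := by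
  obtain ⟨f, rfl, hf⟩ := hR
  obtain ⟨H, _, ι, _, hι, hA, hB⟩ := exists_finitelyPresented_embedding hf
  obtain ⟨j, S, hS, ⟨φ⟩⟩ := Group.IsFinitelyPresented.exists_mulEquiv_presentedGroup (G := H)
  lift S to Finset (FreeGroup (Fin j)) using hS
  have hφ (N : Subgroup (PresentedGroup (Set.range f))) :
      Subgroup.normalClosure ((φ.toMonoidHom.comp ι) '' (N : Set _)) =
        (Subgroup.normalClosure (ι '' (N : Set _))).comap φ.symm.toMonoidHom := by
    rw [← Subgroup.map_equiv_eq_comap_symm', Subgroup.map_normalClosure _ _ φ.surjective,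
      ← Set.image_comp]
    rfl
  refine ⟨j, S, φ.toMonoidHom.comp ι, φ.injective.comp hι,
    tor_eq_normalClosure_and_comap_tor_eq ?_ ?_⟩
  · intro N hN
    rw [hφ, Subgroup.comap_comap]
    convert hA N hN
    ext x
    simp
  · intro N hN g k hk hg
    rw [hφ, Subgroup.mem_comap, map_pow] at hg
    obtain ⟨d, c, hc, h⟩ := hB N hN _ k hk hg
    refine ⟨φ d, c, hc, ?_⟩
    rw [hφ, Subgroup.mem_comap]
    simpa using h
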